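/- arXiv:2002.04007 — 3 statements merged into one kernel-verified Lean document; each statement's English description precedes it below -/
import Mathlib

section
/- Let $\Lambda_2(n) = \Lambda(n) \log n + \sum_{d \mid n} \Lambda(d) \Lambda(n/d)$. Then $\frac{1}{N} \sum_{n \le N} \Lambda_2(n) = 2 \log N \,(1 + o_{N \to \infty}(1))$; that is, $\lim_{N \to \infty} \frac{1}{N \log N} \sum_{n \le N} \Lambda_2(n) = 2$. -/
open Finset in
/-- Summing over the divisors of all `k ≤ N` is summing over the lattice points under the
hyperbola. -/
theorem sum_Ioc_sum_divisorsAntidiagonal {M : Type*} [AddCommMonoid M] (g : ℕ → ℕ → M) (N : ℕ) :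
    ∑ k ∈ Ioc 0 N, ∑ p ∈ k.divisorsAntidiagonal, g p.1 p.2 =
      ∑ d ∈ Ioc 0 N, ∑ m ∈ Ioc 0 (N / d), g d m := by
  rw [sum_sigma', sum_sigma']
  refine sum_bij' (fun x _ => ⟨x.2.1, x.2.2⟩) (fun y _ => ⟨y.1 * y.2, (y.1, y.2)⟩) ?_ ?_ ?_ ?_ ?_
  · rintro ⟨k, d, m⟩ h
    simp only [mem_sigma, mem_Ioc, Nat.mem_divisorsAntidiagonal] at h ⊢
    obtain ⟨⟨hk, hkN⟩, rfl, hne⟩ := h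
    have hd : 0 < d := Nat.pos_of_ne_zero fun h => hne (by simp [h])
    have hm : 0 < m := Nat.pos_of_ne_zero fun h => hne (by simp [h])
    exact ⟨⟨hd, (Nat.le_mul_of_pos_right d hm).trans hkN⟩, hm,
      (Nat.le_div_iff_mul_le hd).2 (by rwa [mul_comm])⟩
  · rintro ⟨d, m⟩ h
    simp only [mem_sigma, mem_Ioc, Nat.mem_divisorsAntidiagonal] at h ⊢
    obtain ⟨⟨hd, -⟩, hm, hmN⟩ := h
    rw [Nat.le_div_iff_mul_le hd, mul_comm] at hmN
    have := Nat.mul_pos hd hm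
    exact ⟨⟨this, hmN⟩, trivial, this.ne'⟩
  · rintro ⟨k, d, m⟩ h
    simp only [mem_sigma, mem_Ioc, Nat.mem_divisorsAntidiagonal] at h
    obtain ⟨-, rfl, -⟩ := h
    rfl
  · rintro ⟨d, m⟩ h
    rfl
  · rintro ⟨k, d, m⟩ h
    rfl

open Finset in
theorem sum_Ioc_sum_Ioc_div_comm {M : Type*} [AddCommMonoid M] (g : ℕ → ℕ → M) (N : ℕ) :
    ∑ d ∈ Ioc 0 N, ∑ m ∈ Ioc 0 (N / d), g d m = ∑ m ∈ Ioc 0 N, ∑ d ∈ Ioc 0 (N / m), g d m := by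
  rw [← sum_Ioc_sum_divisorsAntidiagonal, ← sum_Ioc_sum_divisorsAntidiagonal (fun m d => g d m)]
  refine sum_congr rfl fun k _ => ?_
  rw [Nat.sum_divisorsAntidiagonal g, Nat.sum_divisorsAntidiagonal' (fun m d => g d m)]

open ArithmeticFunction ArithmeticFunction.Moebius Finset in
theorem sum_divisors_moebius_mul_log_div {N k : ℕ} (hN : 0 < N) :
    ∑ d ∈ k.divisors, (μ d : ℝ) * Real.log (N / d) = (if k = 1 then Real.log N else 0) + Λ k := by
  have h1 : ∑ d ∈ k.divisors, (μ d : ℝ) = if k = 1 then 1 else 0 := by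
    rw [← one_apply, ← coe_moebius_mul_coe_zeta, coe_mul_zeta_apply]
    simp
  have h2 : ∀ d ∈ k.divisors, (μ d : ℝ) * Real.log (N / d) =
      μ d * Real.log N - μ d * log d := fun d hd => by
    have hd := Nat.pos_of_mem_divisors hd
    rw [Real.log_div (by positivity) (by positivity), log_apply, mul_sub]
  rw [sum_congr rfl h2, sum_sub_distrib, ← sum_mul, h1, sum_moebius_mul_log_eq]
  split_ifs <;> ring

open ArithmeticFunction ArithmeticFunction.Moebius Finset in
/-- The Tatuzawa–Iseki identity. -/
theorem sum_moebius_mul_log_mul_sum (f : ℝ → ℝ) {N : ℕ} (hN : 0 < N) :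
    ∑ d ∈ Ioc 0 N, (μ d : ℝ) * (Real.log (N / d) * ∑ m ∈ Ioc 0 (N / d), f ((N / d : ℝ) / m)) =
      f N * Real.log N + ∑ k ∈ Ioc 0 N, Λ k * f (N / k) := by
  have h := sum_Ioc_sum_divisorsAntidiagonal
    (fun d m : ℕ => (μ d : ℝ) * Real.log (N / d) * f ((N / d : ℝ) / m)) N
  simp_rw [← mul_assoc, mul_sum]
  rw [← h]
  have h2 : ∀ k ∈ Ioc 0 N, ∑ p ∈ k.divisorsAntidiagonal,
      (μ p.1 : ℝ) * Real.log (N / p.1) * f ((N / p.1 : ℝ) / p.2) =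
      (if k = 1 then f N * Real.log N else 0) + Λ k * f (N / k) := fun k _ => by
    have : ∀ p ∈ k.divisorsAntidiagonal,
        (μ p.1 : ℝ) * Real.log (N / p.1) * f ((N / p.1 : ℝ) / p.2) =
        (μ p.1 : ℝ) * Real.log (N / p.1) * f (N / k) := fun p hp => by
      rw [← (Nat.mem_divisorsAntidiagonal.1 hp).1, div_div]
      push_cast
      rfl
    rw [sum_congr rfl this, ← sum_mul,
      Nat.sum_divisorsAntidiagonal (fun d _ => (μ d : ℝ) * Real.log (N / d)),
      sum_divisors_moebius_mul_log_div hN]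
    split_ifs with h1
    · subst h1; simp [mul_comm]
    · simp
  rw [sum_congr rfl h2, sum_add_distrib, sum_ite_eq']
  simp [Nat.one_le_iff_ne_zero, hN.ne']

open Finset in
theorem mul_log_sub_self_le_sum_log (n : ℕ) :
    n * Real.log n - n ≤ ∑ k ∈ Ioc 0 n, Real.log k := by
  induction n with
  | zero => simp
  | succ n ih =>
    rw [sum_Ioc_succ_top (Nat.zero_le n)]
    rcases Nat.eq_zero_or_pos n with rfl | hn
    · simp
    have hn' : (0 : ℝ) < n := by exact_mod_cast hn
    have h := Real.log_le_sub_one_of_pos (x := (n + 1) / n) (by positivity)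
    rw [Real.log_div (by positivity) (by positivity)] at h
    have h3 := mul_le_mul_of_nonneg_left h hn'.le
    have : (n : ℝ) * ((n + 1) / n - 1) = 1 := by field_simp; ring
    push_cast
    linarith

open Finset in
theorem sum_log_le_mul_log_sub_self_add {n : ℕ} (hn : 0 < n) :
    ∑ k ∈ Ioc 0 n, Real.log k ≤ n * Real.log n - n + Real.log n + 1 := by
  induction n, hn using Nat.le_induction with
  | base => simp
  | succ n hn ih =>
    rw [sum_Ioc_succ_top (Nat.zero_le n)]
    have hn' : (0 : ℝ) < n := by exact_mod_cast hn
    have h := Real.one_sub_inv_le_log_of_pos (x := (n + 1) / n) (by positivity)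
    rw [Real.log_div (by positivity) (by positivity)] at h
    have h3 := mul_le_mul_of_nonneg_left h (by positivity : (0 : ℝ) ≤ n + 1)
    have : ((n : ℝ) + 1) * (1 - ((n + 1) / n : ℝ)⁻¹) = 1 := by field_simp; ring
    push_cast
    linarith

open Finset in
theorem abs_sum_log_sub_le {t : ℝ} (ht : 1 ≤ t) :
    |∑ k ∈ Ioc 0 ⌊t⌋₊, Real.log k - (t * Real.log t - t)| ≤ Real.log t + 2 := by
  have hn : 0 < ⌊t⌋₊ := Nat.floor_pos.2 ht
  have h1 := mul_log_sub_self_le_sum_log ⌊t⌋₊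
  have h2 := sum_log_le_mul_log_sub_self_add hn
  have h3 := Nat.floor_le (zero_le_one.trans ht)
  have h4 := Nat.lt_floor_add_one t
  generalize ⌊t⌋₊ = n at *
  have hn' : (0 : ℝ) < n := by exact_mod_cast hn
  have hlog : Real.log n ≤ Real.log t := Real.log_le_log hn' h3
  have hlt : 0 ≤ Real.log t := Real.log_nonneg ht
  have h5 := Real.log_le_sub_one_of_pos (x := t / n) (by positivity)
  rw [Real.log_div (by positivity) (by positivity)] at h5
  have h6 := mul_le_mul_of_nonneg_left h5 hn'.le
  have h7 : (n : ℝ) * (t / n - 1) = t - n := by field_simp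
  have h8 : (t - n) * Real.log t ≤ Real.log t := by nlinarith
  have h9 : 0 ≤ (t - n) * Real.log t := mul_nonneg (by linarith) hlt
  have h10 := mul_le_mul_of_nonneg_left hlog hn'.le
  rw [abs_le]
  constructor <;> nlinarith

open Finset in
theorem harmonic_cast_eq_sum_Ioc (n : ℕ) : (harmonic n : ℝ) = ∑ m ∈ Ioc 0 n, (m : ℝ)⁻¹ := by
  rw [harmonic_eq_sum_Icc, ← Icc_add_one_left_eq_Ioc]
  simp

theorem abs_mul_harmonic_sub_le {t : ℝ} (ht : 1 ≤ t) :
    |t * harmonic ⌊t⌋₊ - (t * Real.log t + Real.eulerMascheroniConstant * t)| ≤ 2 := by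
  have hn : 0 < ⌊t⌋₊ := Nat.floor_pos.2 ht
  have h1 := Real.eulerMascheroniSeq_lt_eulerMascheroniConstant ⌊t⌋₊
  have h2 := Real.eulerMascheroniConstant_lt_eulerMascheroniSeq' ⌊t⌋₊
  have h3 := Nat.floor_le (zero_le_one.trans ht)
  have h4 := Nat.lt_floor_add_one t
  rw [Real.eulerMascheroniSeq] at h1
  rw [Real.eulerMascheroniSeq', if_neg hn.ne'] at h2
  generalize ⌊t⌋₊ = n at *
  have hn' : (1 : ℝ) ≤ n := by exact_mod_cast hn
  have hlog : Real.log n ≤ Real.log t := Real.log_le_log (by positivity) h3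
  have hlog' : Real.log t ≤ Real.log (n + 1) := Real.log_le_log (by positivity) h4.le
  have h5 := Real.log_le_sub_one_of_pos (x := (n + 1) / n) (by positivity)
  rw [Real.log_div (by positivity) (by positivity)] at h5
  have h7 : ((n : ℝ) + 1) / n - 1 = 1 / n := by field_simp; ring
  rw [h7] at h5
  have h8 : t * (1 / n) ≤ 2 := by
    rw [mul_one_div, div_le_iff₀ (by positivity)]; linarith
  have h9 : |(harmonic n : ℝ) - Real.log t - Real.eulerMascheroniConstant| ≤ 1 / n := by
    rw [abs_le]; constructor <;> linarith
  calc _ = t * |(harmonic n : ℝ) - Real.log t - Real.eulerMascheroniConstant| := by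
        rw [← abs_of_nonneg (zero_le_one.trans ht), ← abs_mul, abs_of_nonneg (zero_le_one.trans ht)]
        ring_nf
    _ ≤ t * (1 / n) := by gcongr
    _ ≤ 2 := h8

open ArithmeticFunction ArithmeticFunction.zeta Finset in
theorem sum_Ioc_psi_div (n : ℕ) :
    ∑ m ∈ Ioc 0 n, Chebyshev.psi (n / m) = ∑ k ∈ Ioc 0 n, Real.log k := by
  have h := sum_Ioc_mul_eq_sum_sum (ζ : ArithmeticFunction ℝ) Λ n
  rw [zeta_mul_vonMangoldt] at h
  simp_rw [← log_apply]
  rw [h]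
  refine sum_congr rfl fun m hm => ?_
  have : m ≠ 0 := by simp at hm; omega
  simp [Chebyshev.psi, Nat.floor_div_natCast, zeta_apply, this]

open Finset in
theorem abs_sum_psi_sub_le {t : ℝ} (ht : 1 ≤ t) :
    |∑ m ∈ Ioc 0 ⌊t⌋₊, (Chebyshev.psi (t / m) - t / m + (Real.eulerMascheroniConstant + 1))| ≤
      Real.log t + 6 := by
  have hpsi : ∑ m ∈ Ioc 0 ⌊t⌋₊, Chebyshev.psi (t / m) = ∑ k ∈ Ioc 0 ⌊t⌋₊, Real.log k := by
    rw [← sum_Ioc_psi_div]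
    refine sum_congr rfl fun m _ => ?_
    simp [Chebyshev.psi, Nat.floor_div_natCast]
  have hdiv : ∑ m ∈ Ioc 0 ⌊t⌋₊, t / m = t * harmonic ⌊t⌋₊ := by
    rw [harmonic_cast_eq_sum_Ioc, mul_sum]; simp_rw [div_eq_mul_inv]
  rw [sum_add_distrib, sum_sub_distrib, hpsi, hdiv]
  have h1 := abs_le.1 (abs_sum_log_sub_le ht)
  have h2 := abs_le.1 (abs_mul_harmonic_sub_le ht)
  have h3 := Nat.floor_le (zero_le_one.trans ht)
  have h4 := Nat.lt_floor_add_one t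
  have h5 := Real.one_half_lt_eulerMascheroniConstant
  have h6 := Real.eulerMascheroniConstant_lt_two_thirds
  simp only [sum_const, Nat.card_Ioc, tsub_zero, nsmul_eq_mul]
  rw [abs_le]
  constructor <;> nlinarith

theorem log_mul_log_add_le_sqrt {t : ℝ} (ht : 1 ≤ t) :
    Real.log t * (Real.log t + 6) ≤ 36 * √t := by
  have h1 : 1 ≤ √t := Real.one_le_sqrt.2 ht
  have h2 : 1 ≤ √√t := Real.one_le_sqrt.2 h1
  have h3 : √√t ^ 2 = √t := Real.sq_sqrt (by positivity)
  have h4 : Real.log t = 4 * Real.log √√t := by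
    rw [Real.log_sqrt (by positivity), Real.log_sqrt (by positivity)]; ring
  have h5 := Real.log_le_sub_one_of_pos (x := √√t) (by positivity)
  have h6 := Real.log_nonneg h2
  calc _ ≤ 4 * √√t * (4 * √√t + 2 * √√t) := by
        rw [h4]
        gcongr ?_ * ?_ <;> linarith
    _ = 24 * √√t ^ 2 := by ring
    _ ≤ 36 * √t := by rw [h3]; linarith

open Finset in
theorem sum_Ioc_one_div_sqrt_le (n : ℕ) : ∑ d ∈ Ioc 0 n, 1 / √(d : ℝ) ≤ 2 * √n := by
  induction n with
  | zero => simp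
  | succ n ih =>
    rw [sum_Ioc_succ_top (Nat.zero_le n)]
    have h : 1 / √((n + 1 : ℕ) : ℝ) ≤ 2 * √((n + 1 : ℕ) : ℝ) - 2 * √n := by
      have hp : 0 < √((n + 1 : ℕ) : ℝ) := Real.sqrt_pos.2 (by positivity)
      have h1 := Real.sq_sqrt (Nat.cast_nonneg (α := ℝ) (n + 1))
      have h2 := Real.sq_sqrt (Nat.cast_nonneg (α := ℝ) n)
      rw [div_le_iff₀ hp]
      push_cast at *
      nlinarith [sq_nonneg (√(n + 1 : ℝ) - √n)]
    linarith

open Finset in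
theorem sum_Ioc_one_div_sq_le {n : ℕ} (hn : 0 < n) :
    ∑ d ∈ Ioc 0 n, 1 / (d : ℝ) ^ 2 ≤ 2 - 1 / (n : ℝ) := by
  induction n, hn using Nat.le_induction with
  | base => norm_num
  | succ n hn ih =>
    rw [sum_Ioc_succ_top (Nat.zero_le n)]
    have hn' : (0 : ℝ) < n := by exact_mod_cast hn
    have h : 1 / ((n : ℝ) + 1) ^ 2 ≤ 1 / n - 1 / (n + 1) := by
      rw [div_sub_div _ _ (by positivity) (by positivity), div_le_div_iff₀ (by positivity)
        (by positivity)]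
      nlinarith
    push_cast
    linarith

open ArithmeticFunction ArithmeticFunction.Moebius Finset in
/-- The Tatuzawa–Iseki identity applied to `ψ x - x + γ + 1`. -/
theorem abs_psi_sub_mul_log_add_sum_le {N : ℕ} (hN : 0 < N) :
    |(Chebyshev.psi N - N + (Real.eulerMascheroniConstant + 1)) * Real.log N +
      ∑ k ∈ Ioc 0 N, Λ k * (Chebyshev.psi (N / k) - N / k + (Real.eulerMascheroniConstant + 1))| ≤
      72 * N := by
  rw [← sum_moebius_mul_log_mul_sum
    (fun x => Chebyshev.psi x - x + (Real.eulerMascheroniConstant + 1)) hN]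
  calc _ ≤ ∑ d ∈ Ioc 0 N, 36 * √(N : ℝ) * (1 / √(d : ℝ)) := by
        refine (abs_sum_le_sum_abs _ _).trans (sum_le_sum fun d hd => ?_)
        rw [mem_Ioc] at hd
        have hd0 : (0 : ℝ) < d := by exact_mod_cast hd.1
        have ht : 1 ≤ (N / d : ℝ) := by
          rw [le_div_iff₀ hd0, one_mul]; exact_mod_cast hd.2
        have hμ : |(μ d : ℝ)| ≤ 1 := by exact_mod_cast abs_moebius_le_one (n := d)
        have h1 := abs_sum_psi_sub_le ht
        rw [Nat.floor_div_natCast, Nat.floor_natCast] at h1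
        rw [abs_mul, abs_mul, abs_of_nonneg (Real.log_nonneg ht)]
        calc _ ≤ 1 * (Real.log (N / d) * (Real.log (N / d) + 6)) := by
              have := Real.log_nonneg ht
              gcongr
          _ ≤ 36 * √(N / d : ℝ) := by rw [one_mul]; exact log_mul_log_add_le_sqrt ht
          _ = _ := by rw [Real.sqrt_div (by positivity)]; ring
    _ ≤ 36 * √(N : ℝ) * (2 * √(N : ℝ)) := by
        rw [← mul_sum]
        gcongr
        exact sum_Ioc_one_div_sqrt_le N
    _ = 72 * N := by
        have := Real.mul_self_sqrt (Nat.cast_nonneg (α := ℝ) N)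
        linear_combination 72 * this

open ArithmeticFunction Finset in
/-- Mertens' estimate for `∑ Λ(k) / k`, before division by `N`. -/
theorem abs_sum_vonMangoldt_mul_div_sub_le {N : ℕ} (hN : 0 < N) :
    |∑ k ∈ Ioc 0 N, Λ k * (N / k : ℝ) - N * Real.log N| ≤ (Real.log 4 + 6) * N := by
  have h1 := mul_log_sub_self_le_sum_log N
  have h2 := sum_log_le_mul_log_sub_self_add hN
  have hS : ∑ k ∈ Ioc 0 N, Real.log k = ∑ k ∈ Ioc 0 N, Λ k * ((N / k : ℕ) : ℝ) := by
    have h := sum_Ioc_mul_zeta_eq_sum Λ N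
    rw [vonMangoldt_mul_zeta] at h
    simpa using h
  have h3 : ∑ k ∈ Ioc 0 N, Λ k * ((N / k : ℕ) : ℝ) ≤ ∑ k ∈ Ioc 0 N, Λ k * (N / k : ℝ) :=
    sum_le_sum fun k _ => mul_le_mul_of_nonneg_left Nat.cast_div_le vonMangoldt_nonneg
  have h4 : ∑ k ∈ Ioc 0 N, Λ k * (N / k : ℝ) ≤
      ∑ k ∈ Ioc 0 N, Λ k * ((N / k : ℕ) : ℝ) + Chebyshev.psi N := by
    rw [Chebyshev.psi, Nat.floor_natCast, ← sum_add_distrib]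
    refine sum_le_sum fun k _ => ?_
    have h := (Nat.lt_floor_add_one (N / k : ℝ)).le
    rw [Nat.floor_div_natCast, Nat.floor_natCast] at h
    have := mul_le_mul_of_nonneg_left h (vonMangoldt_nonneg (n := k))
    linarith
  have h5 := Chebyshev.psi_le_const_mul_self (Nat.cast_nonneg (α := ℝ) N)
  have hN' : (1 : ℝ) ≤ N := by exact_mod_cast hN
  have h6 := Real.log_le_sub_one_of_pos (zero_lt_one.trans_le hN')
  have h7 : 0 ≤ Real.log 4 := Real.log_nonneg (by norm_num)
  rw [abs_le]
  constructor <;> nlinarith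

open ArithmeticFunction Finset in
theorem sum_vonMangoldt_mul_log_div_le {N : ℕ} (hN : 0 < N) :
    ∑ k ∈ Ioc 0 N, Λ k * Real.log (N / k) ≤ 2 * (Real.log 4 + 4) * N := by
  have h7 : 0 ≤ Real.log 4 := Real.log_nonneg (by norm_num)
  calc _ ≤ ∑ k ∈ Ioc 0 N, ∑ m ∈ Ioc 0 (N / k), Λ k * (m : ℝ)⁻¹ := by
        refine sum_le_sum fun k _ => ?_
        have h := log_le_harmonic_floor (N / k : ℝ) (by positivity)
        rw [Nat.floor_div_natCast, Nat.floor_natCast, harmonic_cast_eq_sum_Ioc] at h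
        rw [← mul_sum]
        exact mul_le_mul_of_nonneg_left h vonMangoldt_nonneg
    _ = ∑ m ∈ Ioc 0 N, Chebyshev.psi (N / m) * (m : ℝ)⁻¹ := by
        rw [sum_Ioc_sum_Ioc_div_comm]
        simp [Chebyshev.psi, Nat.floor_div_natCast, sum_mul]
    _ ≤ ∑ m ∈ Ioc 0 N, (Real.log 4 + 4) * N * (1 / (m : ℝ) ^ 2) := by
        refine sum_le_sum fun m _ => ?_
        have h := Chebyshev.psi_le_const_mul_self (x := N / m) (by positivity)
        calc _ ≤ (Real.log 4 + 4) * (N / m) * (m : ℝ)⁻¹ := by gcongr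
          _ = _ := by ring
    _ ≤ (Real.log 4 + 4) * N * 2 := by
        rw [← mul_sum]
        have := sum_Ioc_one_div_sq_le hN
        have : (0 : ℝ) ≤ 1 / N := by positivity
        gcongr
        linarith
    _ = _ := by ring

open ArithmeticFunction Finset in
/-- Selberg's formula with an `O(N)` error term. -/
theorem abs_sum_selberg_sub_le {N : ℕ} (hN : 0 < N) :
    |∑ n ∈ Icc 1 N, (Λ n * Real.log n + ∑ d ∈ n.divisors, Λ d * Λ (n / d)) -
      2 * (N * Real.log N)| ≤ 200 * N := by
  have hN' : (1 : ℝ) ≤ N := by exact_mod_cast hN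
  have hconv : ∑ n ∈ Ioc 0 N, ∑ d ∈ n.divisors, Λ d * Λ (n / d) =
      ∑ k ∈ Ioc 0 N, Λ k * Chebyshev.psi (N / k) := by
    simp_rw [← Nat.sum_divisorsAntidiagonal (fun a b => Λ a * Λ b)]
    rw [sum_Ioc_sum_divisorsAntidiagonal (fun a b => Λ a * Λ b)]
    simp [Chebyshev.psi, Nat.floor_div_natCast, mul_sum]
  have hlog : ∑ k ∈ Ioc 0 N, Λ k * Real.log (N / k) =
      Chebyshev.psi N * Real.log N - ∑ k ∈ Ioc 0 N, Λ k * Real.log k := by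
    rw [Chebyshev.psi, Nat.floor_natCast, sum_mul, ← sum_sub_distrib]
    refine sum_congr rfl fun k hk => ?_
    have hk : (0 : ℝ) < k := by exact_mod_cast (mem_Ioc.1 hk).1
    rw [Real.log_div (by positivity) (by positivity), mul_sub]
  have hlog0 : 0 ≤ ∑ k ∈ Ioc 0 N, Λ k * Real.log (N / k) := by
    refine sum_nonneg fun k hk => mul_nonneg vonMangoldt_nonneg (Real.log_nonneg ?_)
    rw [mem_Ioc] at hk
    rw [le_div_iff₀ (by exact_mod_cast hk.1), one_mul]
    exact_mod_cast hk.2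
  have hlog1 := sum_vonMangoldt_mul_log_div_le hN
  have hM := abs_le.1 (abs_sum_vonMangoldt_mul_div_sub_le hN)
  have hT := abs_psi_sub_mul_log_add_sum_le hN
  have hsplit : ∑ k ∈ Ioc 0 N,
      Λ k * (Chebyshev.psi (N / k) - N / k + (Real.eulerMascheroniConstant + 1)) =
      ∑ k ∈ Ioc 0 N, Λ k * Chebyshev.psi (N / k) - ∑ k ∈ Ioc 0 N, Λ k * (N / k : ℝ) +
        Chebyshev.psi N * (Real.eulerMascheroniConstant + 1) := by
    simp_rw [mul_add _ (_ - _) (_ + _), mul_sub]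
    rw [sum_add_distrib, sum_sub_distrib, ← sum_mul]
    simp [Chebyshev.psi]
  rw [hsplit] at hT
  have hT := abs_le.1 hT
  have hP := Chebyshev.psi_le_const_mul_self (Nat.cast_nonneg (α := ℝ) N)
  have hP0 := Chebyshev.psi_nonneg N
  have hL := Real.log_le_sub_one_of_pos (zero_lt_one.trans_le hN')
  have hL0 := Real.log_nonneg hN'
  have h5 := Real.one_half_lt_eulerMascheroniConstant
  have h6 := Real.eulerMascheroniConstant_lt_two_thirds
  have h7 : Real.log 4 ≤ 3 := (Real.log_le_sub_one_of_pos (by norm_num)).trans (by norm_num)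
  have h8 : 0 ≤ Real.log 4 := Real.log_nonneg (by norm_num)
  rw [show Icc 1 N = Ioc 0 N from Icc_add_one_left_eq_Ioc 0 N, sum_add_distrib, hconv]
  generalize Real.eulerMascheroniConstant = γ at *
  generalize Real.log 4 = c at *
  have h4 : c * N ≤ 3 * N := by gcongr
  have h9 : 0 ≤ Chebyshev.psi N * (γ + 1) := mul_nonneg hP0 (by linarith)
  have h10 : Chebyshev.psi N * (γ + 1) ≤ 2 * ((c + 4) * N) := by nlinarith
  have h11 : 0 ≤ (γ + 1) * Real.log N := mul_nonneg (by linarith) hL0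
  have h12 : (γ + 1) * Real.log N ≤ 2 * N := by nlinarith
  rw [abs_le]
  constructor <;> linarith

open ArithmeticFunction in
/-- Selberg symmetry formula: with `Λ₂(n) = Λ(n) log n + ∑_{d ∣ n} Λ(d) Λ(n/d)`,
`(1/(N log N)) ∑_{n ≤ N} Λ₂(n) → 2` as `N → ∞`. -/
theorem selberg_symmetry :
    Filter.Tendsto (fun N : ℕ => (1 / ((N : ℝ) * Real.log N)) *
        ∑ n ∈ Finset.Icc 1 N, (Λ n * Real.log n + ∑ d ∈ n.divisors, Λ d * Λ (n / d)))
      Filter.atTop (nhds 2) := by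
  have hlim : Filter.Tendsto (fun N : ℕ => 200 / Real.log N) Filter.atTop (nhds 0) :=
    (Real.tendsto_log_atTop.comp tendsto_natCast_atTop_atTop).const_div_atTop 200
  rw [tendsto_iff_dist_tendsto_zero]
  refine squeeze_zero' (Filter.Eventually.of_forall fun _ => dist_nonneg) ?_ hlim
  filter_upwards [Filter.eventually_ge_atTop 2] with N hN
  have h := abs_sum_selberg_sub_le (N := N) (by omega)
  have hN' : (1 : ℝ) < N := by exact_mod_cast hN
  have hL := Real.log_pos hN'
  have hNL : 0 < N * Real.log N := by positivity
  rw [Real.dist_eq]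
  generalize ∑ n ∈ Finset.Icc 1 N, (Λ n * Real.log n + ∑ d ∈ n.divisors, Λ d * Λ (n / d)) = S at *
  rw [show 1 / (N * Real.log N) * S - 2 = (S - 2 * (N * Real.log N)) / (N * Real.log N) by
    field_simp, abs_div, abs_of_pos hNL, div_le_div_iff₀ hNL hL]
  calc _ ≤ 200 * N * Real.log N := by gcongr
    _ = _ := by ring
end

section
/- Let $\varepsilon > 0$ be sufficiently small. Then there exists $k_0$ (depending on $\varepsilon$) such that for every integer $k \ge k_0$, letting $I_k = [(1+\varepsilon)^k, (1+\varepsilon)^{k+1}]$, at least one of the following holds: (i) $\sum_{p \in I_k} \frac{1}{p} \ge \frac{\varepsilon}{k}$, where the sum is over primes $p$ in $I_k$; or (ii) $\sum_{\substack{p_1 p_2 \in I_k \\ p_1, p_2 \ge \exp(\varepsilon^3 k)}} \frac{1}{p_1 p_2} \ge \frac{\varepsilon}{k}$, where the sum is over pairs of primes $(p_1, p_2)$ with $p_1 p_2 \in I_k$ and both $p_1, p_2 \ge \exp(\varepsilon^3 k)$. -/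
namespace SelbergSymmetry

open Finset
open scoped ArithmeticFunction.vonMangoldt ArithmeticFunction.Moebius

/-- The Dirichlet rearrangement of a double sum over the points below a hyperbola. -/
lemma sum_sum_floor_div_eq_sum_filter (x : ℝ) (f : ℕ → ℕ → ℝ) :
    ∑ n ∈ Ioc 0 ⌊x⌋₊, ∑ m ∈ Ioc 0 ⌊x / n⌋₊, f n m =
      ∑ q ∈ Ioc 0 ⌊x⌋₊ ×ˢ Ioc 0 ⌊x⌋₊ with q.1 * q.2 ≤ ⌊x⌋₊, f q.1 q.2 := by
  rw [sum_filter, sum_product]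
  refine sum_congr rfl fun n hn ↦ ?_
  simp only [mem_Ioc] at hn
  rw [← sum_filter]
  refine sum_congr ?_ fun _ _ ↦ rfl
  ext m
  rw [Nat.floor_div_natCast]
  simp only [mem_filter, mem_Ioc, Nat.le_div_iff_mul_le hn.1]
  constructor
  · rintro ⟨h1, h2⟩
    exact ⟨⟨h1, le_trans (Nat.le_mul_of_pos_right m hn.1) h2⟩, by rwa [mul_comm]⟩
  · rintro ⟨⟨h1, _⟩, h2⟩
    exact ⟨h1, by rwa [mul_comm]⟩

lemma sum_sum_floor_div (x : ℝ) (f : ℕ → ℕ → ℝ) :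
    ∑ n ∈ Ioc 0 ⌊x⌋₊, ∑ m ∈ Ioc 0 ⌊x / n⌋₊, f n m =
      ∑ k ∈ Ioc 0 ⌊x⌋₊, ∑ q ∈ k.divisorsAntidiagonal, f q.1 q.2 := by
  have h : ∀ k ∈ Ioc 0 ⌊x⌋₊, ∑ q ∈ k.divisorsAntidiagonal, f q.1 q.2 =
      ∑ q ∈ Ioc 0 ⌊x⌋₊ ×ˢ Ioc 0 ⌊x⌋₊ with q.1 * q.2 = k, f q.1 q.2 := by
    intro k hk
    simp only [mem_Ioc] at hk
    rw [Nat.divisorsAntidiagonal_eq_prod_filter_of_le hk.1.ne' hk.2]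
  rw [sum_sum_floor_div_eq_sum_filter, sum_congr rfl h]
  simp_rw [sum_filter]
  rw [sum_comm]
  refine sum_congr rfl fun q hq ↦ ?_
  simp only [mem_product, mem_Ioc] at hq
  have : 0 < q.1 * q.2 := Nat.mul_pos hq.1.1 hq.2.1
  simp [this]

lemma sum_divisorsAntidiagonal_moebius_mul_log_div {x : ℝ} (hx : 0 < x) (k : ℕ) :
    ∑ q ∈ k.divisorsAntidiagonal, (μ q.1 : ℝ) * Real.log (x / q.1) =
      (if k = 1 then Real.log x else 0) + Λ k := by
  rw [Nat.sum_divisorsAntidiagonal (fun i _ ↦ (μ i : ℝ) * Real.log (x / i))]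
  have h1 : ∀ d ∈ k.divisors, (μ d : ℝ) * Real.log (x / d) =
      (μ d : ℝ) * Real.log x - (μ d : ℝ) * Real.log d := by
    intro d hd
    have : (d : ℝ) ≠ 0 := by
      have := Nat.pos_of_mem_divisors hd
      positivity
    rw [Real.log_div hx.ne' this]
    ring
  rw [sum_congr rfl h1, sum_sub_distrib, ← sum_mul]
  have h2 := ArithmeticFunction.sum_moebius_mul_log_eq (n := k)
  simp only [ArithmeticFunction.log_apply] at h2
  rw [h2]
  have h3 : ∑ d ∈ k.divisors, (μ d : ℝ) = if k = 1 then 1 else 0 := by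
    have := congrArg (fun f : ArithmeticFunction ℤ ↦ f k)
      ArithmeticFunction.moebius_mul_coe_zeta
    simp only [ArithmeticFunction.coe_mul_zeta_apply, ArithmeticFunction.one_apply] at this
    exact_mod_cast this
  rw [h3]
  split_ifs <;> simp

/-- The Tatuzawa–Iseki identity. -/
lemma tatuzawa_iseki (F : ℝ → ℝ) {x : ℝ} (hx : 1 ≤ x) :
    ∑ n ∈ Ioc 0 ⌊x⌋₊, (μ n : ℝ) * (Real.log (x / n) * ∑ m ∈ Ioc 0 ⌊x / n⌋₊, F (x / n / m)) =
      F x * Real.log x + ∑ n ∈ Ioc 0 ⌊x⌋₊, Λ n * F (x / n) := by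
  have h := sum_sum_floor_div x fun n m ↦ (μ n : ℝ) * Real.log (x / n) * F (x / n / m)
  simp_rw [← mul_sum, mul_assoc] at h
  rw [h]
  have h1 : ∀ k ∈ Ioc 0 ⌊x⌋₊, ∑ q ∈ k.divisorsAntidiagonal,
      (μ q.1 : ℝ) * (Real.log (x / q.1) * F (x / q.1 / q.2)) =
      (if k = 1 then F x * Real.log x else 0) + Λ k * F (x / k) := by
    intro k _
    have h2 : ∀ q ∈ k.divisorsAntidiagonal,
        (μ q.1 : ℝ) * (Real.log (x / q.1) * F (x / q.1 / q.2)) =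
        (μ q.1 : ℝ) * Real.log (x / q.1) * F (x / k) := by
      intro q hq
      rw [div_div, ← Nat.cast_mul, (Nat.mem_divisorsAntidiagonal.1 hq).1, mul_assoc]
    rw [sum_congr rfl h2, ← sum_mul,
      sum_divisorsAntidiagonal_moebius_mul_log_div (by linarith)]
    split_ifs with hk1
    · subst hk1; simp; ring
    · ring
  rw [sum_congr rfl h1, sum_add_distrib, sum_ite_eq']
  have : 1 ≤ ⌊x⌋₊ := Nat.one_le_floor_iff x |>.2 hx
  simp [this]

lemma sum_inv_sqrt_le (N : ℕ) : ∑ n ∈ Ioc 0 N, 1 / √(n : ℝ) ≤ 2 * √N := by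
  induction N with
  | zero => simp
  | succ N ih =>
    rw [sum_Ioc_succ_top (Nat.zero_le N)]
    have h1 : (0 : ℝ) < √((N + 1 : ℕ) : ℝ) := Real.sqrt_pos.2 (by positivity)
    have h2 : √((N + 1 : ℕ) : ℝ) ^ 2 = N + 1 := by
      rw [Real.sq_sqrt (by positivity)]; push_cast; ring
    have h3 : √(N : ℝ) ^ 2 = N := Real.sq_sqrt (by positivity)
    have h4 : 1 / √((N + 1 : ℕ) : ℝ) ≤ 2 * √((N + 1 : ℕ) : ℝ) - 2 * √(N : ℝ) := by
      rw [div_le_iff₀ h1]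
      nlinarith [sq_nonneg (√((N + 1 : ℕ) : ℝ) - √(N : ℝ))]
    linarith

lemma log_le_two_mul_sqrt {x : ℝ} (hx : 1 ≤ x) : Real.log x ≤ 2 * √x := by
  have h := Real.log_le_rpow_div (x := x) (ε := 1 / 2) (by linarith) (by norm_num)
  rw [← Real.sqrt_eq_rpow] at h
  linarith

lemma log_mul_add_log_le {x : ℝ} (hx : 1 ≤ x) {C : ℝ} (hC : 0 ≤ C) :
    Real.log x * (C + Real.log x) ≤ (2 * C + 16) * √x := by
  have h := Real.log_le_rpow_div (x := x) (ε := 1 / 4) (by linarith) (by norm_num)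
  have h0 : 0 ≤ Real.log x := Real.log_nonneg hx
  have h1 : (x ^ (1 / 4 : ℝ)) ^ 2 = √x := by
    rw [← Real.rpow_natCast, ← Real.rpow_mul (by linarith), Real.sqrt_eq_rpow]
    norm_num
  have h2 := log_le_two_mul_sqrt hx
  have h3 : Real.log x ^ 2 ≤ (x ^ (1 / 4 : ℝ) / (1 / 4)) ^ 2 := pow_le_pow_left₀ h0 h 2
  nlinarith

lemma abs_log_factorial_sub_le {N : ℕ} (hN : N ≠ 0) :
    |Real.log (N.factorial) - (N * Real.log N - N)| ≤ 1 + Real.log N := by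
  have hN1 : (1 : ℝ) ≤ N := by exact_mod_cast Nat.one_le_iff_ne_zero.2 hN
  have h0 : 0 ≤ Real.log N := Real.log_nonneg hN1
  rw [abs_le]
  constructor
  · have h1 := Stirling.le_log_factorial_stirling hN
    have h2 : 0 ≤ Real.log (2 * Real.pi) := Real.log_nonneg (by linarith [Real.pi_gt_three])
    linarith
  · have key : ∀ n : ℕ, 1 ≤ n →
        Real.log (n.factorial) ≤ n * Real.log n - n + 1 + Real.log n := by
      intro n hn
      induction n, hn using Nat.le_induction with
      | base => simp
      | succ n hn ih =>
        have hn1 : (1 : ℝ) ≤ n := by exact_mod_cast hn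
        rw [Nat.factorial_succ, Nat.cast_mul, Real.log_mul (by positivity) (by positivity)]
        have h3 : 1 / ((n : ℝ) + 1) ≤ Real.log (n + 1) - Real.log n := by
          rw [← Real.log_div (by positivity) (by positivity)]
          have := Real.one_sub_inv_le_log_of_pos (x := ((n : ℝ) + 1) / n) (by positivity)
          refine le_trans (le_of_eq ?_) this
          field_simp
          ring
        rw [div_le_iff₀ (by positivity)] at h3
        push_cast
        nlinarith
    linarith [key N (Nat.one_le_iff_ne_zero.2 hN)]

lemma abs_log_factorial_floor_sub_le {x : ℝ} (hx : 1 ≤ x) :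
    |Real.log (⌊x⌋₊.factorial) - (x * Real.log x - x)| ≤ 3 + 2 * Real.log x := by
  have hN : ⌊x⌋₊ ≠ 0 := (Nat.floor_pos.2 hx).ne'
  set N := ⌊x⌋₊
  have h := abs_log_factorial_sub_le hN
  have hN1 : (1 : ℝ) ≤ N := by exact_mod_cast Nat.one_le_iff_ne_zero.2 hN
  have hle : (N : ℝ) ≤ x := Nat.floor_le (by linarith)
  have hlt : x < N + 1 := Nat.lt_floor_add_one x
  have h1 : Real.log N ≤ Real.log x := Real.log_le_log (by linarith) hle
  have h0 : 0 ≤ Real.log N := Real.log_nonneg hN1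
  have h2 : N * (Real.log x - Real.log N) ≤ x - N := by
    rw [← Real.log_div (by linarith) (by linarith)]
    have := Real.log_le_sub_one_of_pos (x := x / N) (by positivity)
    calc N * Real.log (x / N) ≤ N * (x / N - 1) := by gcongr
      _ = x - N := by field_simp
  rw [abs_le] at h ⊢
  constructor <;> nlinarith

lemma abs_harmonic_floor_sub_le {x : ℝ} (hx : 1 ≤ x) :
    |x * ∑ n ∈ Ioc 0 ⌊x⌋₊, 1 / (n : ℝ) -
      x * (Real.log x + Real.eulerMascheroniConstant)| ≤ 2 := by
  have hN : ⌊x⌋₊ ≠ 0 := (Nat.floor_pos.2 hx).ne'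
  have hle : (⌊x⌋₊ : ℝ) ≤ x := Nat.floor_le (by linarith)
  have hlt : x < ⌊x⌋₊ + 1 := Nat.lt_floor_add_one x
  have hH : ∑ n ∈ Ioc 0 ⌊x⌋₊, 1 / (n : ℝ) = harmonic ⌊x⌋₊ := by
    rw [harmonic_eq_sum_Icc, ← Finset.Icc_add_one_left_eq_Ioc]
    push_cast
    simp
  rw [hH]
  set N := ⌊x⌋₊
  have hN1 : (1 : ℝ) ≤ N := by exact_mod_cast Nat.one_le_iff_ne_zero.2 hN
  have h1 := Real.eulerMascheroniSeq_lt_eulerMascheroniConstant N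
  have h2 := Real.eulerMascheroniConstant_lt_eulerMascheroniSeq' N
  rw [Real.eulerMascheroniSeq] at h1
  rw [Real.eulerMascheroniSeq', if_neg hN] at h2
  have h3 : Real.log x ≤ Real.log (N + 1) := Real.log_le_log (by linarith) hlt.le
  have h4 : Real.log N ≤ Real.log x := Real.log_le_log (by linarith) hle
  have h5 : Real.log (N + 1) - Real.log N ≤ 1 / N := by
    rw [← Real.log_div (by positivity) (by positivity)]
    have := Real.log_le_sub_one_of_pos (x := ((N : ℝ) + 1) / N) (by positivity)
    refine this.trans (le_of_eq ?_)
    field_simp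
    ring
  have h6 : |(harmonic N : ℝ) - (Real.log x + Real.eulerMascheroniConstant)| ≤ 1 / N := by
    rw [abs_le]
    constructor <;> linarith
  rw [← mul_sub, abs_mul, abs_of_nonneg (by linarith : (0 : ℝ) ≤ x)]
  calc x * |(harmonic N : ℝ) - (Real.log x + Real.eulerMascheroniConstant)|
      ≤ (2 * N) * (1 / N) := by gcongr; linarith
    _ = 2 := by field_simp

lemma sum_log_eq_log_factorial (N : ℕ) :
    ∑ k ∈ Ioc 0 N, Real.log k = Real.log N.factorial := by
  induction N with
  | zero => simp
  | succ N ih =>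
    rw [sum_Ioc_succ_top (Nat.zero_le N), ih, Nat.factorial_succ, Nat.cast_mul,
      Real.log_mul (by positivity) (by positivity)]
    ring

lemma sum_psi_div_eq_log_factorial (x : ℝ) :
    ∑ n ∈ Ioc 0 ⌊x⌋₊, Chebyshev.psi (x / n) = Real.log (⌊x⌋₊.factorial) := by
  simp_rw [Chebyshev.psi]
  rw [sum_sum_floor_div x fun _ m ↦ Λ m, ← sum_log_eq_log_factorial]
  refine sum_congr rfl fun k _ ↦ ?_
  rw [Nat.sum_divisorsAntidiagonal' (fun _ i ↦ Λ i), ArithmeticFunction.vonMangoldt_sum]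

lemma sum_vonMangoldt_mul_floor_div (x : ℝ) :
    ∑ n ∈ Ioc 0 ⌊x⌋₊, Λ n * ⌊x / n⌋₊ = Real.log (⌊x⌋₊.factorial) := by
  have h := sum_sum_floor_div x fun n _ ↦ Λ n
  simp only [sum_const, Nat.card_Ioc, tsub_zero, nsmul_eq_mul] at h
  simp_rw [mul_comm (Λ _)]
  rw [h, ← sum_log_eq_log_factorial]
  refine sum_congr rfl fun k _ ↦ ?_
  rw [Nat.sum_divisorsAntidiagonal (fun i _ ↦ Λ i), ArithmeticFunction.vonMangoldt_sum]

lemma psi_le_six_mul {x : ℝ} (hx : 0 ≤ x) : Chebyshev.psi x ≤ 6 * x := by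
  refine (Chebyshev.psi_le_const_mul_self hx).trans ?_
  have : Real.log 4 ≤ 2 := by
    rw [show (4 : ℝ) = 2 ^ 2 by norm_num, Real.log_pow]
    have := Real.log_two_lt_d9
    push_cast
    linarith
  gcongr
  linarith

/-- The first theorem of Mertens, for the von Mangoldt function. -/
lemma abs_sum_vonMangoldt_div_sub_log_le {x : ℝ} (hx : 1 ≤ x) :
    |∑ n ∈ Ioc 0 ⌊x⌋₊, Λ n / n - Real.log x| ≤ 10 := by
  have h1 := abs_log_factorial_floor_sub_le hx
  rw [← sum_vonMangoldt_mul_floor_div, abs_le] at h1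
  have hlog : Real.log x ≤ x := (Real.log_le_sub_one_of_pos (by linarith)).trans (by linarith)
  have hpsi := psi_le_six_mul (x := x) (by linarith)
  have hupper : ∑ n ∈ Ioc 0 ⌊x⌋₊, Λ n * ⌊x / n⌋₊ ≤ x * ∑ n ∈ Ioc 0 ⌊x⌋₊, Λ n / n := by
    rw [mul_sum]
    refine sum_le_sum fun n _ ↦ ?_
    calc Λ n * ⌊x / n⌋₊ ≤ Λ n * (x / n) := by
          gcongr
          exact Nat.floor_le (by positivity)
      _ = x * (Λ n / n) := by ring
  have hlower : x * ∑ n ∈ Ioc 0 ⌊x⌋₊, Λ n / n - Chebyshev.psi x ≤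
      ∑ n ∈ Ioc 0 ⌊x⌋₊, Λ n * ⌊x / n⌋₊ := by
    rw [mul_sum, Chebyshev.psi, ← sum_sub_distrib]
    refine sum_le_sum fun n _ ↦ ?_
    calc x * (Λ n / n) - Λ n = Λ n * (x / n - 1) := by ring
      _ ≤ Λ n * ⌊x / n⌋₊ := by
          gcongr
          linarith [Nat.lt_floor_add_one (x / n)]
  rw [abs_le]
  constructor
  · refine le_of_mul_le_mul_left ?_ (by linarith : 0 < x)
    linarith
  · refine le_of_mul_le_mul_left ?_ (by linarith : 0 < x)
    linarith

/-- The sum of `Λ m * Λ n` over `m * n ≤ x`. -/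
noncomputable def psiTwo (x : ℝ) : ℝ :=
  ∑ n ∈ Ioc 0 ⌊x⌋₊, Λ n * Chebyshev.psi (x / n)

/-- The Selberg symmetry formula. -/
theorem abs_psi_mul_log_add_psiTwo_sub_le {x : ℝ} (hx : 1 ≤ x) :
    |Chebyshev.psi x * Real.log x + psiTwo x - 2 * x * Real.log x| ≤ 116 * x := by
  set γ := Real.eulerMascheroniConstant
  have hγ0 : 1 / 2 < γ := Real.one_half_lt_eulerMascheroniConstant
  have hγ1 : γ < 2 / 3 := Real.eulerMascheroniConstant_lt_two_thirds
  have hG : ∀ t : ℝ, 1 ≤ t → |Real.log t * ∑ m ∈ Ioc 0 ⌊t⌋₊,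
      (Chebyshev.psi (t / m) - t / m + (γ + 1))| ≤ 46 * √t := by
    intro t ht
    have h1 := abs_log_factorial_floor_sub_le ht
    have h2 := abs_harmonic_floor_sub_le ht
    have h3 := log_mul_add_log_le ht (C := 7 / 2) (by norm_num)
    have hle : (⌊t⌋₊ : ℝ) ≤ t := Nat.floor_le (by linarith)
    have hlt : t < ⌊t⌋₊ + 1 := Nat.lt_floor_add_one t
    have h0 : 0 ≤ Real.log t := Real.log_nonneg ht
    have hsum : ∑ m ∈ Ioc 0 ⌊t⌋₊, (Chebyshev.psi (t / m) - t / m + (γ + 1)) =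
        Real.log (⌊t⌋₊.factorial) - t * ∑ n ∈ Ioc 0 ⌊t⌋₊, 1 / (n : ℝ) + (γ + 1) * ⌊t⌋₊ := by
      rw [sum_add_distrib, sum_sub_distrib, sum_psi_div_eq_log_factorial, mul_sum]
      simp [div_eq_mul_inv, mul_comm]
      ring
    have hbound : |∑ m ∈ Ioc 0 ⌊t⌋₊, (Chebyshev.psi (t / m) - t / m + (γ + 1))| ≤
        2 * (7 / 2 + Real.log t) := by
      rw [hsum]
      rw [abs_le] at h1 h2 ⊢
      constructor <;> nlinarith
    rw [abs_mul, abs_of_nonneg h0]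
    calc _ ≤ Real.log t * (2 * (7 / 2 + Real.log t)) := by gcongr
      _ ≤ _ := by linarith
  have hTI := tatuzawa_iseki (fun t ↦ Chebyshev.psi t - t + (γ + 1)) hx
  have hleft : |∑ n ∈ Ioc 0 ⌊x⌋₊, (μ n : ℝ) * (Real.log (x / n) *
      ∑ m ∈ Ioc 0 ⌊x / n⌋₊, (Chebyshev.psi (x / n / m) - x / n / m + (γ + 1)))| ≤ 92 * x := by
    calc _ ≤ ∑ n ∈ Ioc 0 ⌊x⌋₊, 46 * √x * (1 / √(n : ℝ)) := by
          refine (abs_sum_le_sum_abs _ _).trans (sum_le_sum fun n hn ↦ ?_)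
          simp only [mem_Ioc] at hn
          have hn0 : (0 : ℝ) < n := by exact_mod_cast hn.1
          have hnx : (n : ℝ) ≤ x :=
            (Nat.cast_le.2 hn.2).trans (Nat.floor_le (by linarith))
          have h1 := hG (x / n) ((one_le_div hn0).2 hnx)
          have h2 : |(μ n : ℝ)| ≤ 1 := by exact_mod_cast ArithmeticFunction.abs_moebius_le_one
          rw [abs_mul]
          calc _ ≤ 1 * (46 * √(x / n)) := by gcongr
            _ = _ := by rw [Real.sqrt_div (by linarith)]; ring
      _ ≤ 46 * √x * (2 * √(⌊x⌋₊ : ℝ)) := by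
          rw [← mul_sum]
          gcongr
          exact sum_inv_sqrt_le _
      _ ≤ 46 * √x * (2 * √x) := by
          gcongr
          exact Nat.floor_le (by linarith)
      _ = 92 * x := by
          linear_combination 92 * Real.mul_self_sqrt (by linarith : 0 ≤ x)
  rw [hTI] at hleft
  have hright : ∑ n ∈ Ioc 0 ⌊x⌋₊, Λ n * (Chebyshev.psi (x / n) - x / n + (γ + 1)) =
      psiTwo x - x * ∑ n ∈ Ioc 0 ⌊x⌋₊, Λ n / n + (γ + 1) * Chebyshev.psi x := by
    rw [psiTwo, Chebyshev.psi, mul_sum, mul_sum, ← sum_sub_distrib, ← sum_add_distrib]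
    refine sum_congr rfl fun n _ ↦ ?_
    ring
  rw [hright] at hleft
  have hM := abs_sum_vonMangoldt_div_sub_log_le hx
  have hlog : Real.log x ≤ x := (Real.log_le_sub_one_of_pos (by linarith)).trans (by linarith)
  have h0 : 0 ≤ Real.log x := Real.log_nonneg hx
  have hpsi := psi_le_six_mul (x := x) (by linarith)
  have hpsi0 := Chebyshev.psi_nonneg x
  rw [abs_le] at hleft hM ⊢
  constructor <;> nlinarith

lemma psiTwo_eq_sum_filter (x : ℝ) :
    psiTwo x = ∑ q ∈ Ioc 0 ⌊x⌋₊ ×ˢ Ioc 0 ⌊x⌋₊ with q.1 * q.2 ≤ ⌊x⌋₊, Λ q.1 * Λ q.2 := by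
  rw [← sum_sum_floor_div_eq_sum_filter x fun m n ↦ Λ m * Λ n, psiTwo]
  simp_rw [Chebyshev.psi, mul_sum]

lemma psiTwo_sub_psiTwo {x y : ℝ} (hxy : x ≤ y) :
    psiTwo y - psiTwo x = ∑ q ∈ Ioc 0 ⌊y⌋₊ ×ˢ Ioc 0 ⌊y⌋₊ with
      ⌊x⌋₊ < q.1 * q.2 ∧ q.1 * q.2 ≤ ⌊y⌋₊, Λ q.1 * Λ q.2 := by
  have hfl : ⌊x⌋₊ ≤ ⌊y⌋₊ := Nat.floor_mono hxy
  have h : psiTwo x =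
      ∑ q ∈ Ioc 0 ⌊y⌋₊ ×ˢ Ioc 0 ⌊y⌋₊ with q.1 * q.2 ≤ ⌊x⌋₊, Λ q.1 * Λ q.2 := by
    rw [psiTwo_eq_sum_filter]
    refine sum_congr ?_ fun _ _ ↦ rfl
    ext q
    simp only [mem_filter, mem_product, mem_Ioc]
    constructor
    · rintro ⟨⟨⟨h1, h2⟩, h3, h4⟩, h5⟩
      exact ⟨⟨⟨h1, h2.trans hfl⟩, h3, h4.trans hfl⟩, h5⟩
    · rintro ⟨⟨⟨h1, _⟩, h3, _⟩, h5⟩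
      exact ⟨⟨⟨h1, (Nat.le_mul_of_pos_right _ h3).trans h5⟩, h3,
        (Nat.le_mul_of_pos_left _ h1).trans h5⟩, h5⟩
  rw [h, psiTwo_eq_sum_filter, sub_eq_iff_eq_add, sum_filter, sum_filter, sum_filter,
    ← sum_add_distrib]
  refine sum_congr rfl fun q _ ↦ ?_
  by_cases h1 : q.1 * q.2 ≤ ⌊x⌋₊
  · simp [h1, h1.trans hfl, not_lt.2 h1]
  · simp [h1, not_le.1 h1]

lemma sum_filter_mul_vonMangoldt_le {y : ℝ} (hy : 0 ≤ y) {f : ℕ → ℝ} (hf : ∀ n, 0 ≤ f n) :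
    ∑ q ∈ Ioc 0 ⌊y⌋₊ ×ˢ Ioc 0 ⌊y⌋₊ with q.1 * q.2 ≤ ⌊y⌋₊, f q.1 * Λ q.2 ≤
      6 * y * ∑ n ∈ Ioc 0 ⌊y⌋₊, f n / n := by
  rw [← sum_sum_floor_div_eq_sum_filter y fun m n ↦ f m * Λ n, mul_sum]
  refine sum_le_sum fun n _ ↦ ?_
  rw [← mul_sum]
  calc _ ≤ f n * (6 * (y / n)) :=
        mul_le_mul_of_nonneg_left (psi_le_six_mul (by positivity)) (hf n)
    _ = _ := by ring

lemma exists_sum_vonMangoldt_div_not_prime_le :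
    ∃ E : ℝ, ∀ N : ℕ, ∑ n ∈ Ioc 0 N, (if n.Prime then 0 else Λ n) / (n : ℝ) ≤ E := by
  have h := ArithmeticFunction.vonMangoldt.summable_residueClass_non_primes_div (1 : ZMod 1)
  have hres : ∀ n : ℕ, ArithmeticFunction.vonMangoldt.residueClass (1 : ZMod 1) n = Λ n := by
    intro n
    simp [ArithmeticFunction.vonMangoldt.residueClass, Subsingleton.elim _ (1 : ZMod 1)]
  simp_rw [hres] at h
  refine ⟨_, fun N ↦ h.sum_le_tsum _ fun n _ ↦ ?_⟩
  split_ifs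
  · simp
  · exact div_nonneg ArithmeticFunction.vonMangoldt_nonneg n.cast_nonneg

/-- The contribution to `psiTwo y - psiTwo x` of the pairs that are not pairs of primes `≥ z`
is small. -/
lemma exists_psiTwo_sub_psiTwo_le :
    ∃ E : ℝ, ∀ x y z : ℝ, x ≤ y → 0 ≤ y → 1 ≤ z → ∀ T : Finset (ℕ × ℕ),
      (∀ p q : ℕ, p.Prime → q.Prime → z ≤ p → z ≤ q → x ≤ (p * q : ℕ) → ((p * q : ℕ) : ℝ) ≤ y →
        (p, q) ∈ T) →
      psiTwo y - psiTwo x ≤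
        ∑ q ∈ T, Real.log q.1 * Real.log q.2 + 12 * y * (E + Real.log z) := by
  obtain ⟨E, hE⟩ := exists_sum_vonMangoldt_div_not_prime_le
  refine ⟨E + 10, fun x y z hxy hy hz T hT ↦ ?_⟩
  classical
  have hΛ : ∀ n : ℕ, 0 ≤ Λ n := fun _ ↦ ArithmeticFunction.vonMangoldt_nonneg
  set f : ℕ → ℝ := fun n ↦ if n.Prime ∧ z ≤ n then 0 else Λ n with hfdef
  have hf : ∀ n, 0 ≤ f n := fun n ↦ by
    simp only [hfdef]
    split_ifs
    exacts [le_rfl, hΛ n]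
  have hfsum : ∑ n ∈ Ioc 0 ⌊y⌋₊, f n / n ≤ E + 10 + Real.log z := by
    have hM := (abs_le.1 (abs_sum_vonMangoldt_div_sub_log_le hz)).2
    have h1 : ∑ n ∈ Ioc 0 ⌊y⌋₊, f n / n ≤
        ∑ n ∈ Ioc 0 ⌊y⌋₊, ((if n.Prime then 0 else Λ n) / (n : ℝ) +
          if n ≤ ⌊z⌋₊ then Λ n / n else 0) := by
      refine sum_le_sum fun n _ ↦ ?_
      have h0 : 0 ≤ Λ n / n := div_nonneg (hΛ n) n.cast_nonneg
      by_cases hp : n.Prime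
      · by_cases hzn : z ≤ n
        · simp only [hfdef, hp, hzn, and_self, if_true, zero_div, zero_add]
          split_ifs <;> simp [h0]
        · have : n ≤ ⌊z⌋₊ := Nat.le_floor (not_le.1 hzn).le
          simp [hfdef, hp, hzn, this]
      · simp only [hfdef, hp, false_and, if_false]
        split_ifs <;> simp [h0]
    have h2 : ∑ n ∈ Ioc 0 ⌊y⌋₊, (if n ≤ ⌊z⌋₊ then Λ n / (n : ℝ) else 0) ≤
        ∑ n ∈ Ioc 0 ⌊z⌋₊, Λ n / n := by
      rw [← sum_filter]
      refine sum_le_sum_of_subset_of_nonneg ?_ fun n _ _ ↦ div_nonneg (hΛ n) n.cast_nonneg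
      intro n hn
      simp only [mem_filter, mem_Ioc] at hn ⊢
      exact ⟨hn.1.1, hn.2⟩
    rw [sum_add_distrib] at h1
    linarith [hE ⌊y⌋₊]
  set B := {q ∈ Ioc 0 ⌊y⌋₊ ×ˢ Ioc 0 ⌊y⌋₊ | q.1 * q.2 ≤ ⌊y⌋₊} with hB
  have hB1 : ∑ q ∈ B, f q.1 * Λ q.2 ≤ 6 * y * (E + 10 + Real.log z) :=
    (sum_filter_mul_vonMangoldt_le hy hf).trans (by gcongr)
  have hB2 : ∑ q ∈ B, Λ q.1 * f q.2 = ∑ q ∈ B, f q.1 * Λ q.2 := by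
    refine sum_nbij' Prod.swap Prod.swap ?_ ?_ (by simp) (by simp) ?_
    · intro q hq
      simp only [hB, mem_filter, mem_product, Prod.fst_swap, Prod.snd_swap] at hq ⊢
      exact ⟨hq.1.symm, by rw [mul_comm]; exact hq.2⟩
    · intro q hq
      simp only [hB, mem_filter, mem_product, Prod.fst_swap, Prod.snd_swap] at hq ⊢
      exact ⟨hq.1.symm, by rw [mul_comm]; exact hq.2⟩
    · intro q _
      simp [mul_comm]
  have hlog : ∀ q : ℕ × ℕ, 0 ≤ Real.log q.1 * Real.log q.2 := fun q ↦
    mul_nonneg (Real.log_natCast_nonneg _) (Real.log_natCast_nonneg _)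
  have hmain : psiTwo y - psiTwo x ≤ ∑ q ∈ B, ((if q ∈ T then Real.log q.1 * Real.log q.2 else 0)
      + f q.1 * Λ q.2 + Λ q.1 * f q.2) := by
    rw [psiTwo_sub_psiTwo hxy]
    have hsub : {q ∈ Ioc 0 ⌊y⌋₊ ×ˢ Ioc 0 ⌊y⌋₊ | ⌊x⌋₊ < q.1 * q.2 ∧ q.1 * q.2 ≤ ⌊y⌋₊} ⊆ B := by
      intro q hq
      simp only [hB, mem_filter] at hq ⊢
      exact ⟨hq.1, hq.2.2⟩
    have hnn : ∀ q : ℕ × ℕ, 0 ≤ (if q ∈ T then Real.log q.1 * Real.log q.2 else 0)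
      + f q.1 * Λ q.2 + Λ q.1 * f q.2 := by
      intro q
      have h1 := mul_nonneg (hf q.1) (hΛ q.2)
      have h2 := mul_nonneg (hΛ q.1) (hf q.2)
      split_ifs
      · linarith [hlog q]
      · linarith
    refine le_trans (sum_le_sum fun q hq ↦ ?_)
      (sum_le_sum_of_subset_of_nonneg hsub fun q _ _ ↦ hnn q)
    simp only [mem_filter] at hq
    have h1 := mul_nonneg (hf q.1) (hΛ q.2)
    have h2 := mul_nonneg (hΛ q.1) (hf q.2)
    have h3 : 0 ≤ if q ∈ T then Real.log q.1 * Real.log q.2 else 0 := by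
      split_ifs
      exacts [hlog q, le_rfl]
    by_cases hq1 : q.1.Prime ∧ z ≤ q.1
    · by_cases hq2 : q.2.Prime ∧ z ≤ q.2
      · have hmem : q ∈ T := hT q.1 q.2 hq1.1 hq2.1 hq1.2 hq2.2
          (Nat.lt_of_floor_lt hq.2.1).le ((Nat.le_floor_iff hy).1 hq.2.2)
        simp [hfdef, hq1, hq2, hmem, ArithmeticFunction.vonMangoldt_apply_prime]
      · have : f q.2 = Λ q.2 := if_neg hq2
        rw [this]
        linarith
    · have : f q.1 = Λ q.1 := if_neg hq1
      rw [this]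
      linarith
  have hTsum : ∑ q ∈ B, (if q ∈ T then Real.log q.1 * Real.log q.2 else 0) ≤
      ∑ q ∈ T, Real.log q.1 * Real.log q.2 := by
    rw [← sum_filter]
    refine sum_le_sum_of_subset_of_nonneg ?_ fun q _ _ ↦ hlog q
    intro q hq
    exact (mem_filter.1 hq).2
  rw [sum_add_distrib, sum_add_distrib, hB2] at hmain
  linarith

/-- The Selberg symmetry formula on `[x, y]`, with `P` and `T` collecting the primes and the
semiprimes without small prime factor. -/
lemma exists_selberg_lower_bound :
    ∃ K : ℝ, 0 < K ∧ ∀ x y z : ℝ, 1 ≤ x → x ≤ y → y ≤ 2 * x → 1 ≤ z →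
      ∀ (P : Finset ℕ) (T : Finset (ℕ × ℕ)),
      (∀ p : ℕ, p.Prime → x ≤ p → (p : ℝ) ≤ y → p ∈ P) →
      (∀ p q : ℕ, p.Prime → q.Prime → z ≤ p → z ≤ q → x ≤ (p * q : ℕ) → ((p * q : ℕ) : ℝ) ≤ y →
        (p, q) ∈ T) →
      2 * (y - x) * Real.log x ≤ (∑ p ∈ P, Real.log p) * Real.log x +
        ∑ q ∈ T, Real.log q.1 * Real.log q.2 + 24 * x * Real.log z + K * x := by
  obtain ⟨E, hE⟩ := exists_psiTwo_sub_psiTwo_le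
  obtain ⟨D, hD⟩ := Chebyshev.psi_sub_theta_le_mul_sqrt
  refine ⟨348 + 12 + 4 * |D| + 24 * |E|, by positivity,
    fun x y z hx hxy hyx hz P T hP hT ↦ ?_⟩
  have hx0 : 0 < x := by linarith
  have hy0 : 0 < y := by linarith
  have h1 := (abs_le.1 (abs_psi_mul_log_add_psiTwo_sub_le hx)).2
  have h2 := (abs_le.1 (abs_psi_mul_log_add_psiTwo_sub_le (hx.trans hxy))).1
  have h3 := hE x y z hxy hy0.le hz T hT
  have hlx : 0 ≤ Real.log x := Real.log_nonneg hx
  have hlz : 0 ≤ Real.log z := Real.log_nonneg hz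
  have hlog : Real.log x ≤ Real.log y := Real.log_le_log hx0 hxy
  have hlog2 : Real.log y - Real.log x ≤ 1 := by
    rw [← Real.log_div hy0.ne' hx0.ne']
    have h4 : y / x ≤ 2 := (div_le_iff₀ hx0).2 hyx
    have := Real.log_le_sub_one_of_pos (x := y / x) (by positivity)
    linarith
  have hpsi := psi_le_six_mul hy0.le
  have hpsi0 := Chebyshev.psi_nonneg y
  have htheta : Chebyshev.theta y - Chebyshev.theta x ≤ ∑ p ∈ P, Real.log p := by
    have hfl : ⌊x⌋₊ ≤ ⌊y⌋₊ := Nat.floor_mono hxy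
    rw [sub_le_iff_le_add, Chebyshev.theta, Chebyshev.theta]
    have hsub : {p ∈ Ioc 0 ⌊y⌋₊ | p.Prime} ⊆ P ∪ {p ∈ Ioc 0 ⌊x⌋₊ | p.Prime} := by
      intro p hp
      simp only [mem_filter, mem_Ioc, mem_union] at hp ⊢
      by_cases hpx : p ≤ ⌊x⌋₊
      · exact Or.inr ⟨⟨hp.1.1, hpx⟩, hp.2⟩
      · exact Or.inl (hP p hp.2 (Nat.lt_of_floor_lt (not_le.1 hpx)).le
          ((Nat.le_floor_iff hy0.le).1 hp.1.2))
    refine (sum_le_sum_of_subset_of_nonneg hsub fun p _ _ ↦ Real.log_natCast_nonneg p).trans ?_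
    rw [← sum_union_inter]
    exact le_add_of_nonneg_right (sum_nonneg fun p _ ↦ Real.log_natCast_nonneg p)
  have hdiff : Chebyshev.psi y - Chebyshev.psi x ≤ ∑ p ∈ P, Real.log p + |D| * √y := by
    have h5 := hD y
    have h6 := Chebyshev.theta_le_psi x
    have h7 : D * √y ≤ |D| * √y := by gcongr; exact le_abs_self D
    linarith
  have hsqrt : √y * Real.log x ≤ 4 * x := by
    have h5 : √y ≤ 2 * √x := by
      rw [show 2 * √x = √(4 * x) by
        rw [Real.sqrt_mul (by norm_num), show (4 : ℝ) = 2 ^ 2 by norm_num,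
          Real.sqrt_sq (by norm_num)]]
      exact Real.sqrt_le_sqrt (by linarith)
    calc √y * Real.log x ≤ (2 * √x) * (2 * √x) := by
          gcongr
          exact log_le_two_mul_sqrt hx
      _ = 4 * x := by linear_combination 4 * Real.mul_self_sqrt hx0.le
  have hpsilog : Chebyshev.psi y * Real.log y - Chebyshev.psi x * Real.log x ≤
      (∑ p ∈ P, Real.log p) * Real.log x + 4 * |D| * x + 12 * x := by
    calc _ = (Chebyshev.psi y - Chebyshev.psi x) * Real.log x +
          Chebyshev.psi y * (Real.log y - Real.log x) := by ring
      _ ≤ (∑ p ∈ P, Real.log p + |D| * √y) * Real.log x + Chebyshev.psi y * 1 := by gcongr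
      _ = (∑ p ∈ P, Real.log p) * Real.log x + |D| * (√y * Real.log x) +
          Chebyshev.psi y := by ring
      _ ≤ (∑ p ∈ P, Real.log p) * Real.log x + |D| * (4 * x) + 12 * x := by
          gcongr
          linarith
      _ = _ := by ring
  have hEx : 12 * y * (E + Real.log z) ≤ 24 * x * |E| + 24 * x * Real.log z := by
    calc 12 * y * (E + Real.log z) ≤ 12 * y * (|E| + Real.log z) := by
          gcongr
          exact le_abs_self E
      _ ≤ 12 * (2 * x) * (|E| + Real.log z) := by gcongr
      _ = _ := by ring
  have hmono : 2 * y * Real.log x ≤ 2 * y * Real.log y := by gcongr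
  linarith

end SelbergSymmetry


open scoped Classical in
/-- At each scale there are many primes or many semiprimes: for every sufficiently small
`ε > 0` there is `k₀` such that for all `k ≥ k₀`, with `I_k = [(1+ε)^k, (1+ε)^{k+1}]`,
either `∑_{p ∈ I_k} 1/p ≥ ε/k` or
`∑_{p₁ p₂ ∈ I_k, p₁, p₂ ≥ exp(ε³ k)} 1/(p₁ p₂) ≥ ε/k`. -/
theorem many_primes_or_semiprimes :
    ∃ ε₀ : ℝ, 0 < ε₀ ∧ ∀ ε : ℝ, 0 < ε → ε < ε₀ →
      ∃ k₀ : ℕ, ∀ k : ℕ, k₀ ≤ k →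
        (ε / k ≤ ∑ p ∈ (Finset.Icc 1 ⌊(1 + ε) ^ (k + 1)⌋₊).filter
              (fun p : ℕ => p.Prime ∧ (1 + ε) ^ k ≤ (p : ℝ) ∧ (p : ℝ) ≤ (1 + ε) ^ (k + 1)),
            (1 / (p : ℝ))) ∨
        (ε / k ≤ ∑ q ∈ (Finset.Icc 1 ⌊(1 + ε) ^ (k + 1)⌋₊ ×ˢ
              Finset.Icc 1 ⌊(1 + ε) ^ (k + 1)⌋₊).filter
              (fun q => q.1.Prime ∧ q.2.Prime ∧
                (1 + ε) ^ k ≤ ((q.1 * q.2 : ℕ) : ℝ) ∧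
                ((q.1 * q.2 : ℕ) : ℝ) ≤ (1 + ε) ^ (k + 1) ∧
                Real.exp (ε ^ 3 * k) ≤ (q.1 : ℝ) ∧ Real.exp (ε ^ 3 * k) ≤ (q.2 : ℝ)),
            (1 / ((q.1 : ℝ) * (q.2 : ℝ)))) := by
  obtain ⟨K, hK, hmain⟩ := SelbergSymmetry.exists_selberg_lower_bound
  refine ⟨1 / 72, by norm_num, fun ε hε hε0 ↦ ?_⟩
  obtain ⟨k₀, hk₀⟩ := exists_nat_gt (2 * K / ε ^ 2)
  refine ⟨max 1 k₀, fun k hk ↦ ?_⟩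
  have hk1 : (1 : ℝ) ≤ k := by exact_mod_cast (le_max_left _ _).trans hk
  have hkK : 2 * K < k * ε ^ 2 := by
    rw [← div_lt_iff₀ (by positivity)]
    exact hk₀.trans_le (by exact_mod_cast (le_max_right _ _).trans hk)
  have hε1 : (1 : ℝ) ≤ 1 + ε := by linarith
  set x := (1 + ε) ^ k with hx
  set y := (1 + ε) ^ (k + 1) with hy
  have hyx : y = (1 + ε) * x := by rw [hy, hx, pow_succ]; ring
  have hx1 : 1 ≤ x := one_le_pow₀ hε1
  have hxy : x ≤ y := by rw [hyx]; nlinarith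
  have hy2 : y ≤ 2 * x := by rw [hyx]; gcongr; linarith
  have hz : 1 ≤ Real.exp (ε ^ 3 * k) := Real.one_le_exp (by positivity)
  have hx0 : 0 < x := by linarith
  have hy0 : 0 < y := by linarith
  have hL1 : Real.log (1 + ε) ≤ ε := by
    linarith [Real.log_le_sub_one_of_pos (x := 1 + ε) (by linarith)]
  have hL2 : ε / 2 ≤ Real.log (1 + ε) := by
    have h := Real.one_sub_inv_le_log_of_pos (x := 1 + ε) (by linarith)
    refine le_trans ?_ h
    rw [← sub_nonneg, show 1 - (1 + ε)⁻¹ - ε / 2 = ε * (1 - ε) / (2 * (1 + ε)) by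
      field_simp; ring]
    exact div_nonneg (mul_nonneg hε.le (by linarith)) (by linarith)
  have hlogx : Real.log x = k * Real.log (1 + ε) := by rw [hx, Real.log_pow]
  have hlogxle : Real.log x ≤ k * ε := by rw [hlogx]; gcongr
  have hlogxge : k * (ε / 2) ≤ Real.log x := by rw [hlogx]; gcongr
  have hlogx0 : 0 ≤ Real.log x := Real.log_nonneg hx1
  have hlogy0 : 0 ≤ Real.log y := Real.log_nonneg (hx1.trans hxy)
  have hlogyle : Real.log y ≤ 2 * (k * ε) := by
    rw [hy, Real.log_pow]
    push_cast
    calc ((k : ℝ) + 1) * Real.log (1 + ε) ≤ (2 * k) * ε := by gcongr <;> linarith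
      _ = _ := by ring
  have hlog_le : ∀ n ∈ Finset.Icc 1 ⌊y⌋₊, Real.log (n : ℝ) ≤ Real.log y := by
    intro n hn
    rw [Finset.mem_Icc] at hn
    exact Real.log_le_log (by exact_mod_cast hn.1) ((Nat.le_floor_iff hy0.le).1 hn.2)
  by_contra! hcon
  obtain ⟨hconP, hconT⟩ := hcon
  set P := (Finset.Icc 1 ⌊y⌋₊).filter (fun p : ℕ => p.Prime ∧ x ≤ (p : ℝ) ∧ (p : ℝ) ≤ y) with hPdef
  set T := (Finset.Icc 1 ⌊y⌋₊ ×ˢ Finset.Icc 1 ⌊y⌋₊).filter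
    (fun q => q.1.Prime ∧ q.2.Prime ∧ x ≤ ((q.1 * q.2 : ℕ) : ℝ) ∧ ((q.1 * q.2 : ℕ) : ℝ) ≤ y ∧
      Real.exp (ε ^ 3 * k) ≤ (q.1 : ℝ) ∧ Real.exp (ε ^ 3 * k) ≤ (q.2 : ℝ)) with hTdef
  have h := hmain x y _ hx1 hxy hy2 hz P T
    (fun p hp hxp hpy ↦ by
      rw [hPdef, Finset.mem_filter, Finset.mem_Icc]
      exact ⟨⟨hp.one_le, Nat.le_floor hpy⟩, hp, hxp, hpy⟩)
    (fun p q hp hq hzp hzq hxpq hpqy ↦ by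
      rw [hTdef, Finset.mem_filter, Finset.mem_product, Finset.mem_Icc, Finset.mem_Icc]
      have hle : p * q ≤ ⌊y⌋₊ := Nat.le_floor hpqy
      exact ⟨⟨⟨hp.one_le, (Nat.le_mul_of_pos_right _ hq.pos).trans hle⟩, hq.one_le,
        (Nat.le_mul_of_pos_left _ hp.pos).trans hle⟩, hp, hq, hxpq, hpqy, hzp, hzq⟩)
  have hP : ∑ p ∈ P, Real.log p ≤ y * Real.log y * (ε / k) := by
    refine le_trans ?_ (mul_le_mul_of_nonneg_left hconP.le (by positivity))
    rw [Finset.mul_sum]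
    refine Finset.sum_le_sum fun p hp ↦ ?_
    rw [hPdef, Finset.mem_filter] at hp
    have hp0 : (0 : ℝ) < p := by exact_mod_cast hp.2.1.pos
    have h1 : 1 ≤ y / p := (one_le_div hp0).2 hp.2.2.2
    calc Real.log p ≤ Real.log y := hlog_le p hp.1
      _ ≤ y / p * Real.log y := le_mul_of_one_le_left hlogy0 h1
      _ = _ := by ring
  have hT : ∑ q ∈ T, Real.log q.1 * Real.log q.2 ≤ y * Real.log y ^ 2 * (ε / k) := by
    refine le_trans ?_ (mul_le_mul_of_nonneg_left hconT.le (by positivity))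
    rw [Finset.mul_sum]
    refine Finset.sum_le_sum fun q hq ↦ ?_
    rw [hTdef, Finset.mem_filter, Finset.mem_product] at hq
    have hq0 : (0 : ℝ) < ((q.1 * q.2 : ℕ) : ℝ) := by
      exact_mod_cast Nat.mul_pos hq.2.1.pos hq.2.2.1.pos
    have h1 : 1 ≤ y / ((q.1 * q.2 : ℕ) : ℝ) := (one_le_div hq0).2 hq.2.2.2.2.1
    calc Real.log q.1 * Real.log q.2 ≤ Real.log y * Real.log y :=
          mul_le_mul (hlog_le _ hq.1.1) (hlog_le _ hq.1.2) (Real.log_natCast_nonneg _) hlogy0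
      _ ≤ y / ((q.1 * q.2 : ℕ) : ℝ) * (Real.log y * Real.log y) :=
          le_mul_of_one_le_left (by positivity) h1
      _ = _ := by push_cast; ring
  have hPle : (∑ p ∈ P, Real.log p) * Real.log x ≤ 4 * x * k * ε ^ 3 := by
    calc _ ≤ (2 * x) * (2 * (k * ε)) * (ε / k) * (k * ε) :=
          mul_le_mul (hP.trans (by gcongr)) hlogxle hlogx0 (by positivity)
      _ = _ := by field_simp; ring
  have hTle : ∑ q ∈ T, Real.log q.1 * Real.log q.2 ≤ 8 * x * k * ε ^ 3 := by
    calc _ ≤ (2 * x) * (2 * (k * ε)) ^ 2 * (ε / k) := hT.trans (by gcongr)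
      _ = _ := by field_simp; ring
  have hlower : x * k * ε ^ 2 ≤ 2 * (y - x) * Real.log x := by
    calc x * k * ε ^ 2 = 2 * (ε * x) * (k * (ε / 2)) := by ring
      _ ≤ 2 * (ε * x) * Real.log x := by gcongr
      _ = _ := by rw [hyx]; ring
  rw [Real.log_exp] at h
  have hfinal : x * (k * ε ^ 2) ≤ x * (36 * ε * (k * ε ^ 2) + K) := by linarith
  have hfinal' := le_of_mul_le_mul_left hfinal hx0
  have hkε : 36 * ε * (k * ε ^ 2) ≤ 1 / 2 * (k * ε ^ 2) := by
    gcongr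
    linarith
  linarith
end

section
/- The prime number theorem holds: $\lim_{N \to \infty} \frac{1}{N} \sum_{n \le N} \Lambda(n) = 1$, where the sum is over positive integers $n \le N$. Equivalently, the number of primes $\le N$ equals $(1 + o_{N\to\infty}(1)) \frac{N}{\log N}$. -/
open MeasureTheory Set Filter Topology FourierTransform

namespace PrimeNumberTheorem

/-- Integrating the Laplace transform of a bounded function along a vertical line against a
compactly supported weight. -/
lemma integral_mul_laplace_eq {A : ℝ → ℝ} (hA : Measurable A) {C : ℝ} (hC : ∀ u, |A u| ≤ C)
    {φ : ℝ → ℂ} (hφ : Continuous φ) (hφc : HasCompactSupport φ) {σ : ℝ} (hσ : 0 < σ) (y : ℝ) :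
    ∫ t : ℝ, Complex.exp (2 * Real.pi * t * y * Complex.I) * φ t *
        ∫ u in Ioi (0 : ℝ), (A u : ℂ) * Complex.exp (-(σ + 2 * Real.pi * t * Complex.I) * u) =
      ∫ u in Ioi (0 : ℝ), (A u : ℂ) * Complex.exp (-σ * u) * 𝓕 φ (u - y) := by
  have hexp : IntegrableOn (fun u : ℝ ↦ Complex.exp (-σ * u)) (Ioi 0) :=
    integrableOn_exp_mul_complex_Ioi (by simpa using hσ) 0
  have hAexp : IntegrableOn (fun u : ℝ ↦ (A u : ℂ) * Complex.exp (-σ * u)) (Ioi 0) :=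
    hexp.bdd_mul (by fun_prop) (ae_of_all _ fun u ↦ by simpa using hC u)
  have hφi : Integrable φ := hφ.integrable_of_hasCompactSupport hφc
  have hprod : Integrable (Function.uncurry fun t u : ℝ ↦
      Complex.exp ((-2 * Real.pi * t * (u - y) : ℝ) * Complex.I) *
        (φ t * ((A u : ℂ) * Complex.exp (-σ * u)))) (volume.prod (volume.restrict (Ioi 0))) := by
    refine (hφi.mul_prod hAexp).bdd_mul (c := 1) (by fun_prop) (ae_of_all _ fun p ↦ ?_)
    rw [Complex.norm_exp_ofReal_mul_I]
  calc
    _ = ∫ t : ℝ, ∫ u in Ioi (0 : ℝ), Complex.exp ((-2 * Real.pi * t * (u - y) : ℝ) * Complex.I) *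
        (φ t * ((A u : ℂ) * Complex.exp (-σ * u))) := by
      refine integral_congr_ae (ae_of_all _ fun t ↦ ?_)
      simp only
      rw [← integral_const_mul]
      refine integral_congr_ae (ae_of_all _ fun u ↦ ?_)
      have : Complex.exp (2 * Real.pi * t * y * Complex.I) *
          Complex.exp (-(σ + 2 * Real.pi * t * Complex.I) * u) =
          Complex.exp ((-2 * Real.pi * t * (u - y) : ℝ) * Complex.I) *
          Complex.exp (-σ * u) := by
        rw [← Complex.exp_add, ← Complex.exp_add]
        congr 1
        push_cast
        ring
      simp only
      linear_combination (φ t * A u) * this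
    _ = _ := by
      rw [integral_integral_swap hprod]
      refine integral_congr_ae (ae_of_all _ fun u ↦ ?_)
      simp only
      rw [Real.fourier_real_eq_integral_exp_smul, ← integral_const_mul]
      refine integral_congr_ae (ae_of_all _ fun t ↦ ?_)
      simp only [smul_eq_mul]
      ring

/-- If the Laplace transform of a bounded function `A` extends continuously to the closed right
half-plane, then the averages of `A` against translates of a band-limited kernel tend to zero. -/
theorem tendsto_setIntegral_mul_fourier_sub {A : ℝ → ℝ} (hA : Measurable A) {C : ℝ}
    (hC : ∀ u, |A u| ≤ C) {g : ℂ → ℂ} (hg : ContinuousOn g {s | 0 ≤ s.re})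
    (hL : ∀ s : ℂ, 0 < s.re → ∫ u in Ioi (0 : ℝ), (A u : ℂ) * Complex.exp (-s * u) = g s)
    {φ : ℝ → ℂ} (hφ : Continuous φ) (hφc : HasCompactSupport φ) (hφi : Integrable (𝓕 φ)) :
    Tendsto (fun y : ℝ ↦ ∫ u in Ioi (0 : ℝ), (A u : ℂ) * 𝓕 φ (u - y)) atTop (𝓝 0) := by
  have hline : Continuous fun p : ℝ × ℝ ↦ ((p.1 : ℂ) + 2 * Real.pi * p.2 * Complex.I) := by
    fun_prop
  have hgc : ContinuousOn (fun p : ℝ × ℝ ↦ g (p.1 + 2 * Real.pi * p.2 * Complex.I))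
      (Ici 0 ×ˢ univ) :=
    hg.comp hline.continuousOn fun p hp ↦ by simpa using hp
  have hgt {σ : ℝ} (hσ : 0 ≤ σ) : Continuous fun t : ℝ ↦ g (σ + 2 * Real.pi * t * Complex.I) :=
    hgc.comp_continuous (f := fun t : ℝ ↦ (σ, t)) (by fun_prop) fun t ↦ by simpa using hσ
  have key (y : ℝ) : ∫ u in Ioi (0 : ℝ), (A u : ℂ) * 𝓕 φ (u - y) =
      ∫ t : ℝ, Complex.exp (2 * Real.pi * t * y * Complex.I) * φ t *
        g ((0 : ℝ) + 2 * Real.pi * t * Complex.I) := by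
    obtain ⟨M, hM⟩ := ((isCompact_Icc (a := (0 : ℝ)) (b := 1)).prod
      hφc.isCompact).exists_bound_of_continuousOn
      (hgc.mono (prod_mono Icc_subset_Ici_self (subset_univ _)))
    have h1 : Tendsto (fun σ : ℝ ↦ ∫ t : ℝ, Complex.exp (2 * Real.pi * t * y * Complex.I) * φ t *
        g (σ + 2 * Real.pi * t * Complex.I)) (𝓝[>] 0)
        (𝓝 (∫ t : ℝ, Complex.exp (2 * Real.pi * t * y * Complex.I) * φ t *
          g ((0 : ℝ) + 2 * Real.pi * t * Complex.I))) := by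
      refine tendsto_integral_filter_of_dominated_convergence (fun t ↦ ‖φ t‖ * M) ?_ ?_
        ((hφ.integrable_of_hasCompactSupport hφc).norm.mul_const M) (ae_of_all _ fun t ↦ ?_)
      · filter_upwards [self_mem_nhdsWithin] with σ hσ
        have := hgt (le_of_lt hσ)
        exact (Continuous.mul (by fun_prop) this).aestronglyMeasurable
      · filter_upwards [Ioc_mem_nhdsGT (zero_lt_one' ℝ)] with σ hσ
        refine ae_of_all _ fun t ↦ ?_
        have : ‖Complex.exp (2 * Real.pi * t * y * Complex.I)‖ = 1 := by
          exact_mod_cast Complex.norm_exp_ofReal_mul_I (2 * Real.pi * t * y)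
        rw [norm_mul, norm_mul, this, one_mul]
        by_cases ht : t ∈ tsupport φ
        · exact mul_le_mul_of_nonneg_left (hM (σ, t) ⟨Ioc_subset_Icc_self hσ, ht⟩) (norm_nonneg _)
        · simp [image_eq_zero_of_notMem_tsupport ht]
      · refine Tendsto.const_mul _ ?_
        have h := (hgc (0, t) ⟨self_mem_Ici, mem_univ _⟩).tendsto
        refine h.comp (f := fun σ : ℝ ↦ (σ, t)) (tendsto_nhdsWithin_iff.2 ⟨?_, ?_⟩)
        · exact (Continuous.tendsto (by fun_prop : Continuous fun σ : ℝ ↦ (σ, t)) 0).mono_left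
            nhdsWithin_le_nhds
        · filter_upwards [self_mem_nhdsWithin] with σ hσ
          exact ⟨(mem_Ioi.1 hσ).le, mem_univ _⟩
    have h2 : Tendsto (fun σ : ℝ ↦ ∫ u in Ioi (0 : ℝ), (A u : ℂ) * Complex.exp (-σ * u) *
        𝓕 φ (u - y)) (𝓝[>] 0) (𝓝 (∫ u in Ioi (0 : ℝ), (A u : ℂ) * 𝓕 φ (u - y))) := by
      have hi : Integrable (fun u : ℝ ↦ 𝓕 φ (u - y)) := hφi.comp_sub_right y
      refine tendsto_integral_filter_of_dominated_convergence (fun u ↦ C * ‖𝓕 φ (u - y)‖) ?_ ?_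
        (hi.norm.const_mul C).integrableOn (ae_of_all _ fun u ↦ ?_)
      · refine Eventually.of_forall fun σ ↦ ?_
        exact AEStronglyMeasurable.mul (by fun_prop) hi.integrableOn.aestronglyMeasurable
      · filter_upwards [self_mem_nhdsWithin] with σ hσ
        filter_upwards [ae_restrict_mem measurableSet_Ioi] with u hu
        have he : ‖Complex.exp (-σ * u)‖ ≤ 1 := by
          rw [Complex.norm_exp]
          simpa using (mul_pos (mem_Ioi.1 hσ) hu).le
        rw [norm_mul, norm_mul, Complex.norm_real]
        gcongr
        exact (mul_le_of_le_one_right (norm_nonneg _) he).trans (hC u)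
      · have : Continuous fun σ : ℝ ↦ (A u : ℂ) * Complex.exp (-σ * u) * 𝓕 φ (u - y) := by
          fun_prop
        simpa using (this.tendsto 0).mono_left nhdsWithin_le_nhds
    refine tendsto_nhds_unique (h2.congr' ?_) h1
    filter_upwards [self_mem_nhdsWithin] with σ hσ
    rw [← integral_mul_laplace_eq hA hC hφ hφc hσ]
    refine integral_congr_ae (ae_of_all _ fun t ↦ ?_)
    simp only
    rw [hL _ (by simpa using hσ)]
  simp_rw [key]
  refine ((Real.zero_at_infty_fourier fun t : ℝ ↦
    φ t * g ((0 : ℝ) + 2 * Real.pi * t * Complex.I)).comp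
    (tendsto_neg_atTop_atBot.mono_right atBot_le_cocompact)).congr fun y ↦ ?_
  rw [Function.comp_apply, Real.fourier_real_eq_integral_exp_smul]
  refine integral_congr_ae (ae_of_all _ fun t ↦ ?_)
  simp only [smul_eq_mul, mul_assoc]
  congr 2
  push_cast
  ring

/-- There is a nonnegative, integrable, nonzero kernel which is the Fourier transform of a
continuous compactly supported function. -/
lemma exists_nonneg_bandlimited_kernel :
    ∃ (φ : ℝ → ℂ) (K : ℝ → ℝ), Continuous φ ∧ HasCompactSupport φ ∧ (∀ v, 𝓕 φ v = K v) ∧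
      (∀ v, 0 ≤ K v) ∧ Integrable K ∧ 0 < ∫ v, K v := by
  let f : ContDiffBump (0 : ℝ) := ⟨1, 2, by norm_num, by norm_num⟩
  let ψ : ℝ → ℂ := fun t ↦ (f t : ℂ)
  have hψ : ContDiff ℝ (⊤ : ℕ∞) ψ := Complex.ofRealCLM.contDiff.comp f.contDiff
  have hψc : HasCompactSupport ψ := f.hasCompactSupport.comp_left (g := Complex.ofReal) rfl
  let S := hψc.toSchwartzMap hψ
  let F : SchwartzMap ℝ ℂ := 𝓕 S
  have hS : 𝓕 ψ = F := (SchwartzMap.fourier_coe S).symm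
  have hψi : Integrable ψ := hψ.continuous.integrable_of_hasCompactSupport hψc
  have hreal (v : ℝ) : 𝓕 ψ v = ((𝓕 ψ v).re : ℂ) := by
    refine (Complex.conj_eq_iff_re.1 ?_).symm
    rw [Real.fourier_real_eq_integral_exp_smul, ← integral_conj, ← integral_neg_eq_self]
    refine integral_congr_ae (ae_of_all _ fun t ↦ ?_)
    simp only [smul_eq_mul, map_mul, ← Complex.exp_conj, ψ, f.neg, Complex.conj_ofReal,
      Complex.conj_I]
    congr 2
    push_cast
    ring
  have hcont : Continuous fun v ↦ (𝓕 ψ v).re ^ 2 := by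
    rw [hS]
    fun_prop
  have hsq : Integrable fun v ↦ (𝓕 ψ v).re ^ 2 := by
    have h : Integrable fun v ↦ (𝓕 ψ v).re := by
      rw [hS]
      exact F.integrable.re
    obtain ⟨M, hM⟩ := F.decay 0 0
    simp_rw [sq]
    refine h.bdd_mul (c := M) h.aestronglyMeasurable (ae_of_all _ fun v ↦ ?_)
    refine (Complex.abs_re_le_norm _).trans ?_
    simpa [hS] using hM.2 v
  refine ⟨convolution ψ ψ (ContinuousLinearMap.mul ℂ ℂ), fun v ↦ (𝓕 ψ v).re ^ 2,
    hψc.continuous_convolution_left _ hψ.continuous hψi.locallyIntegrable,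
    hψc.convolution _ hψc, fun v ↦ ?_, fun v ↦ sq_nonneg _, hsq, ?_⟩
  · rw [Real.fourier_mul_convolution_eq hψi hψi, hreal v]
    simp [sq]
  · rw [integral_pos_iff_support_of_nonneg (fun v ↦ sq_nonneg _) hsq]
    refine hcont.isOpen_support.measure_pos _ ⟨0, ?_⟩
    have h0 : 𝓕 ψ 0 = ((∫ t, f t : ℝ) : ℂ) := by
      rw [Real.fourier_real_eq_integral_exp_smul, ← integral_complex_ofReal]
      simp [ψ]
    simp only [Function.mem_support, h0, Complex.ofReal_re]
    exact (pow_pos f.integral_pos 2).ne'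

/-- Band-limited probability kernels concentrated near the origin. -/
lemma exists_concentrated_bandlimited_kernel {x : ℝ} (hx : 0 < x) :
    ∃ (φ : ℝ → ℂ) (K : ℝ → ℝ), Continuous φ ∧ HasCompactSupport φ ∧ (∀ v, 𝓕 φ v = K v) ∧
      (∀ v, 0 ≤ K v) ∧ Integrable K ∧ ∫ v, K v = 1 ∧ 1 - x ≤ ∫ v in Ioc (-x) x, K v := by
  obtain ⟨φ, K, hφ, hφc, hK, hK0, hKi, hpos⟩ := exists_nonneg_bandlimited_kernel
  set m := ∫ v, K v
  have hlim : Tendsto (fun c : ℝ ↦ m⁻¹ * ∫ v in (c * -x)..(c * x), K v) atTop (𝓝 1) := by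
    have h := (intervalIntegral_tendsto_integral hKi
      (tendsto_id.atTop_mul_const_of_neg (neg_lt_zero.2 hx))
      (tendsto_id.atTop_mul_const hx)).const_mul m⁻¹
    rwa [inv_mul_cancel₀ hpos.ne'] at h
  obtain ⟨c, hc, hc0⟩ := ((hlim.eventually_const_le (sub_lt_self 1 hx)).and
    (eventually_gt_atTop 0)).exists
  have hφc' : HasCompactSupport fun t ↦ φ (t / c) := by
    simpa [div_eq_mul_inv, Function.comp_def] using
      hφc.comp_homeomorph (Homeomorph.mulRight₀ c⁻¹ (inv_ne_zero hc0.ne'))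
  refine ⟨fun t ↦ (m⁻¹ : ℝ) * φ (t / c), fun v ↦ m⁻¹ * (c * K (c * v)), by fun_prop, hφc'.mul_left,
    fun v ↦ ?_, fun v ↦ ?_, ?_, ?_, ?_⟩
  · rw [Real.fourier_real_eq_integral_exp_smul]
    push_cast
    rw [← hK, Real.fourier_real_eq_integral_exp_smul]
    have h := Measure.integral_comp_div (fun t : ℝ ↦
      Complex.exp ((-2 * Real.pi * t * (c * v) : ℝ) * Complex.I) • φ t) c
    rw [abs_of_pos hc0, Complex.real_smul] at h
    rw [← h, ← integral_const_mul]
    refine integral_congr_ae (ae_of_all _ fun t ↦ ?_)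
    have : -2 * Real.pi * (t / c) * (c * v) = -2 * Real.pi * t * v := by field_simp
    simp only [this, smul_eq_mul]
    push_cast
    ring
  · have := hK0 (c * v)
    positivity
  · exact ((hKi.comp_mul_left' hc0.ne').const_mul c).const_mul m⁻¹
  · rw [integral_const_mul, integral_const_mul, Measure.integral_comp_mul_left,
      abs_of_pos (inv_pos.2 hc0), smul_eq_mul, mul_inv_cancel_left₀ hc0.ne']
    exact inv_mul_cancel₀ hpos.ne'
  · rw [← intervalIntegral.integral_of_le (by linarith), intervalIntegral.integral_const_mul,
      intervalIntegral.integral_const_mul, intervalIntegral.integral_comp_mul_left _ hc0.ne',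
      smul_eq_mul, mul_inv_cancel_left₀ hc0.ne']
    exact hc

lemma tendsto_setIntegral_Ioi_comp_sub {K : ℝ → ℝ} (hK : Integrable K) :
    Tendsto (fun y : ℝ ↦ ∫ u in Ioi (0 : ℝ), K (u - y)) atTop (𝓝 (∫ v, K v)) := by
  refine ((aecover_Ioi tendsto_neg_atTop_atBot).integral_tendsto_of_countably_generated hK).congr
    fun y ↦ ?_
  simpa [← integral_indicator measurableSet_Ioi, indicator, neg_lt_sub_iff_lt_add] using
    (integral_sub_right_eq_self (fun v ↦ (Ioi (-y)).indicator K v) y).symm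

/-- Comparison of a slowly decreasing function with its averages against a concentrated kernel. -/
lemma average_bounds {H : ℝ → ℝ} (hH : Measurable H) {C : ℝ} (h0 : ∀ u, 0 ≤ H u)
    (hC : ∀ u, H u ≤ C) (hmono : ∀ u v, u ≤ v → H u ≤ Real.exp (v - u) * H v)
    {K : ℝ → ℝ} (hK0 : ∀ v, 0 ≤ K v) (hK : Integrable K) (hK1 : ∫ v, K v = 1) {x : ℝ}
    (hKx : 1 - x ≤ ∫ v in Ioc (-x) x, K v) {y : ℝ} (hxy : x ≤ y) :
    (1 - x) * Real.exp (-2 * x) * H (y - x) ≤ ∫ u in Ioi (0 : ℝ), H u * K (u - y) ∧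
      ∫ u in Ioi (0 : ℝ), H u * K (u - y) ≤ Real.exp (2 * x) * H (y + x) + C * x := by
  set S := Ioc (y - x) (y + x)
  have hS : MeasurableSet S := measurableSet_Ioc
  have hSsub : S ⊆ Ioi 0 := fun u hu ↦ lt_of_le_of_lt (sub_nonneg.2 hxy) hu.1
  have hKy : Integrable fun u ↦ K (u - y) := hK.comp_sub_right y
  have hHK : Integrable fun u ↦ H u * K (u - y) :=
    hKy.bdd_mul (c := C) hH.aestronglyMeasurable
      (ae_of_all _ fun u ↦ by rw [Real.norm_of_nonneg (h0 u)]; exact hC u)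
  have hHK0 (u : ℝ) : 0 ≤ H u * K (u - y) := mul_nonneg (h0 u) (hK0 _)
  have hC0 : 0 ≤ C := (h0 0).trans (hC 0)
  have hp : ∫ u in S, K (u - y) = ∫ v in Ioc (-x) x, K v := by
    rw [← integral_indicator hS, ← integral_indicator measurableSet_Ioc,
      ← integral_sub_right_eq_self (fun v ↦ (Ioc (-x) x).indicator K v) y]
    congr 1 with u
    simp only [indicator, S, mem_Ioc]
    congr 1
    exact propext ⟨fun h ↦ ⟨by linarith [h.1], by linarith [h.2]⟩,
      fun h ↦ ⟨by linarith [h.1], by linarith [h.2]⟩⟩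
  have htot : ∫ u, K (u - y) = 1 := by rw [integral_sub_right_eq_self, hK1]
  have hcompl : ∫ u in Sᶜ, K (u - y) ≤ x := by
    have := integral_add_compl hS hKy
    linarith
  have hpart : ∫ u in S, K (u - y) ≤ 1 :=
    htot ▸ setIntegral_le_integral hKy (ae_of_all _ fun u ↦ hK0 _)
  constructor
  · calc
      _ ≤ (Real.exp (-2 * x) * H (y - x)) * ∫ u in S, K (u - y) := by
        rw [mul_assoc, mul_comm]
        have := h0 (y - x)
        gcongr
        exact hp ▸ hKx
      _ = ∫ u in S, (Real.exp (-2 * x) * H (y - x)) * K (u - y) :=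
        (integral_const_mul _ _).symm
      _ ≤ ∫ u in S, H u * K (u - y) := by
        refine setIntegral_mono_on (hKy.const_mul _).integrableOn hHK.integrableOn hS fun u hu ↦ ?_
        refine mul_le_mul_of_nonneg_right ?_ (hK0 _)
        calc
          _ ≤ Real.exp (-2 * x) * (Real.exp (u - (y - x)) * H u) := by
            gcongr
            exact hmono _ _ hu.1.le
          _ = Real.exp (u - (y + x)) * H u := by
            rw [← mul_assoc, ← Real.exp_add]
            ring_nf
          _ ≤ 1 * H u := by
            gcongr
            · exact h0 u
            · exact Real.exp_le_one_iff.2 (sub_nonpos.2 hu.2)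
          _ = H u := one_mul _
      _ ≤ _ := setIntegral_mono_set hHK.integrableOn (ae_of_all _ hHK0) hSsub.eventuallyLE
  · calc
      _ = (∫ u in S, H u * K (u - y)) + ∫ u in Ioi 0 \ S, H u * K (u - y) := by
        rw [← setIntegral_union disjoint_sdiff_right (measurableSet_Ioi.diff hS) hHK.integrableOn
          hHK.integrableOn, union_sdiff_cancel hSsub]
      _ ≤ Real.exp (2 * x) * H (y + x) + C * x := by
        gcongr ?_ + ?_
        · calc
            _ ≤ ∫ u in S, (Real.exp (2 * x) * H (y + x)) * K (u - y) := by
              refine setIntegral_mono_on hHK.integrableOn (hKy.const_mul _).integrableOn hS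
                fun u hu ↦ mul_le_mul_of_nonneg_right ((hmono _ _ hu.2).trans ?_) (hK0 _)
              gcongr
              · exact h0 _
              · linarith [hu.1]
            _ = (Real.exp (2 * x) * H (y + x)) * ∫ u in S, K (u - y) := integral_const_mul _ _
            _ ≤ _ := mul_le_of_le_one_right (mul_nonneg (Real.exp_nonneg _) (h0 _)) hpart
        · calc
            _ ≤ ∫ u in Sᶜ, H u * K (u - y) :=
              setIntegral_mono_set hHK.integrableOn (ae_of_all _ hHK0)
                (show Ioi 0 \ S ⊆ Sᶜ from fun u hu ↦ hu.2).eventuallyLE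
            _ ≤ ∫ u in Sᶜ, C * K (u - y) :=
              setIntegral_mono hHK.integrableOn (hKy.const_mul _).integrableOn
                fun u ↦ mul_le_mul_of_nonneg_right (hC u) (hK0 _)
            _ = C * ∫ u in Sᶜ, K (u - y) := integral_const_mul _ _
            _ ≤ _ := by gcongr

/-- A Tauberian theorem: a bounded function `H` such that `exp u * H u` is nonnegative and
increasing tends to `1` as soon as its averages against band-limited kernels do. -/
theorem tendsto_one_of_tendsto_bandlimited {H : ℝ → ℝ} (hH : Measurable H) {C : ℝ}
    (h0 : ∀ u, 0 ≤ H u) (hC : ∀ u, H u ≤ C)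
    (hmono : ∀ u v, u ≤ v → H u ≤ Real.exp (v - u) * H v)
    (hlim : ∀ φ : ℝ → ℂ, Continuous φ → HasCompactSupport φ → Integrable (𝓕 φ) →
      Tendsto (fun y : ℝ ↦ ∫ u in Ioi (0 : ℝ), ((H u - 1 : ℝ) : ℂ) * 𝓕 φ (u - y)) atTop (𝓝 0)) :
    Tendsto H atTop (𝓝 1) := by
  have key {x : ℝ} (hx : 0 < x) : ∀ᶠ y in atTop,
      (1 - x) * Real.exp (-2 * x) * H y ≤ 1 + x ∧ 1 - x ≤ Real.exp (2 * x) * H y + C * x := by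
    obtain ⟨φ, K, hφ, hφc, hφK, hK0, hK, hK1, hKx⟩ := exists_concentrated_bandlimited_kernel hx
    have hI : Tendsto (fun y : ℝ ↦ ∫ u in Ioi (0 : ℝ), H u * K (u - y)) atTop (𝓝 1) := by
      have h1 := hlim φ hφ hφc (by rw [funext hφK]; exact hK.ofReal)
      simp_rw [hφK, ← Complex.ofReal_mul, integral_complex_ofReal] at h1
      have h2 := (Complex.continuous_re.tendsto _).comp h1
      have h3 := h2.add (tendsto_setIntegral_Ioi_comp_sub hK)
      simp only [Complex.zero_re, hK1, zero_add] at h3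
      refine h3.congr fun y ↦ ?_
      have hKy : Integrable fun u ↦ K (u - y) := hK.comp_sub_right y
      have hHK : Integrable fun u ↦ H u * K (u - y) :=
        hKy.bdd_mul (c := C) hH.aestronglyMeasurable
          (ae_of_all _ fun u ↦ by rw [Real.norm_of_nonneg (h0 u)]; exact hC u)
      simp only [Function.comp_apply, Complex.ofReal_re, sub_mul, one_mul]
      rw [integral_sub hHK.integrableOn hKy.integrableOn, sub_add_cancel]
    have hup : ∀ᶠ y in atTop, ∫ u in Ioi (0 : ℝ), H u * K (u - y) ≤ 1 + x :=
      hI.eventually_le_const (by linarith)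
    have hlow : ∀ᶠ y in atTop, 1 - x ≤ ∫ u in Ioi (0 : ℝ), H u * K (u - y) :=
      hI.eventually_const_le (by linarith)
    have hav : ∀ y, x ≤ y → _ := fun y hy ↦ average_bounds hH h0 hC hmono hK0 hK hK1 hKx hy
    filter_upwards [(tendsto_atTop_add_const_right _ x tendsto_id).eventually hup,
      (tendsto_atTop_add_const_right _ (-x) tendsto_id).eventually hlow,
      eventually_ge_atTop (2 * x)] with y h1 h2 hy
    constructor
    · simpa using (hav (y + x) (by linarith)).1.trans h1
    · simpa using h2.trans (hav (y + -x) (by linarith)).2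
  refine tendsto_order.2 ⟨fun a ha ↦ ?_, fun b hb ↦ ?_⟩
  · have hc : Tendsto (fun x : ℝ ↦ (1 - x - C * x) * Real.exp (-(2 * x))) (𝓝[>] 0) (𝓝 1) := by
      have : Continuous fun x : ℝ ↦ (1 - x - C * x) * Real.exp (-(2 * x)) := by fun_prop
      simpa using (this.tendsto 0).mono_left nhdsWithin_le_nhds
    obtain ⟨x, hxa, hx⟩ := ((hc.eventually_const_lt ha).and self_mem_nhdsWithin).exists
    filter_upwards [key hx] with y hy
    refine hxa.trans_le ?_
    rw [Real.exp_neg, ← div_eq_mul_inv, div_le_iff₀' (Real.exp_pos _)]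
    linarith [hy.2]
  · have hc : Tendsto (fun x : ℝ ↦ (1 + x) / ((1 - x) * Real.exp (-2 * x))) (𝓝[>] 0) (𝓝 1) := by
      have : ContinuousAt (fun x : ℝ ↦ (1 + x) / ((1 - x) * Real.exp (-2 * x))) 0 :=
        ContinuousAt.div (by fun_prop) (by fun_prop) (by simp)
      simpa using this.tendsto.mono_left nhdsWithin_le_nhds
    obtain ⟨x, hxb, hx⟩ :=
      ((hc.eventually_lt_const hb).and (Ioo_mem_nhdsGT (zero_lt_one' ℝ))).exists
    filter_upwards [key hx.1] with y hy
    refine lt_of_le_of_lt ?_ hxb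
    rw [le_div_iff₀' (mul_pos (sub_pos.2 hx.2) (Real.exp_pos _))]
    exact hy.1

open ArithmeticFunction

/-- The normalised Chebyshev function `ψ (exp u) / exp u`. -/
noncomputable def psiExp (u : ℝ) : ℝ := Chebyshev.psi (Real.exp u) * Real.exp (-u)

lemma measurable_psiExp : Measurable psiExp :=
  (Chebyshev.psi_mono.measurable.comp Real.measurable_exp).mul (by fun_prop)

lemma psiExp_nonneg (u : ℝ) : 0 ≤ psiExp u :=
  mul_nonneg (Chebyshev.psi_nonneg _) (Real.exp_nonneg _)

lemma psiExp_le (u : ℝ) : psiExp u ≤ Real.log 4 + 4 := by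
  rw [psiExp, Real.exp_neg, ← div_eq_mul_inv, div_le_iff₀ (Real.exp_pos u)]
  exact Chebyshev.psi_le_const_mul_self (Real.exp_nonneg u)

lemma psiExp_le_exp_mul {u v : ℝ} (h : u ≤ v) : psiExp u ≤ Real.exp (v - u) * psiExp v := by
  have hv : Real.exp (v - u) * psiExp v = Chebyshev.psi (Real.exp v) * Real.exp (-u) := by
    rw [psiExp, mul_left_comm, ← Real.exp_add]
    ring_nf
  rw [hv, psiExp]
  gcongr

lemma sum_Icc_one_vonMangoldt (x : ℝ) :
    ∑ k ∈ Finset.Icc 1 ⌊x⌋₊, Λ k = Chebyshev.psi x := by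
  rw [Chebyshev.psi_eq_sum_Icc, ← Finset.insert_Icc_add_one_left_eq_Icc (Nat.zero_le _)]
  simp

lemma LSeries_vonMangoldt_eq_mul_laplace {s : ℂ} (hs : 0 < s.re) :
    LSeries (fun n ↦ (Λ n : ℂ)) (1 + s) =
      (1 + s) * ∫ u in Ioi (0 : ℝ), (psiExp u : ℂ) * Complex.exp (-s * u) := by
  have hO : (fun n : ℕ ↦ ∑ k ∈ Finset.Icc 1 n, Λ k) =O[atTop] fun n ↦ (n : ℝ) ^ (1 : ℝ) := by
    refine Asymptotics.IsBigO.of_bound (Real.log 4 + 4) (Eventually.of_forall fun n ↦ ?_)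
    have h := sum_Icc_one_vonMangoldt n
    rw [Nat.floor_natCast] at h
    rw [h, Real.rpow_one, Real.norm_of_nonneg (Chebyshev.psi_nonneg _),
      Real.norm_of_nonneg n.cast_nonneg]
    exact Chebyshev.psi_le_const_mul_self n.cast_nonneg
  rw [LSeries_eq_mul_integral_of_nonneg (fun n ↦ Λ n) zero_le_one (by simpa using hs) hO
    fun _ ↦ vonMangoldt_nonneg]
  congr 1
  have himg : Ioi (1 : ℝ) = Real.exp '' Ioi 0 := by simp
  rw [himg, integral_image_eq_integral_abs_deriv_smul measurableSet_Ioi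
    (fun u _ ↦ (Real.hasDerivAt_exp u).hasDerivWithinAt) Real.exp_injective.injOn]
  refine integral_congr_ae (ae_of_all _ fun u ↦ ?_)
  have hpow : ((Real.exp u : ℝ) : ℂ) ^ (-(1 + s + 1)) = Complex.exp (-(1 + s + 1) * u) := by
    rw [Complex.cpow_def_of_ne_zero (by exact_mod_cast (Real.exp_pos u).ne'),
      ← Complex.ofReal_log (Real.exp_nonneg u), Real.log_exp, mul_comm]
  have hexp : Complex.exp u * Complex.exp (-(1 + s + 1) * u) =
      Complex.exp (-u) * Complex.exp (-s * u) := by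
    rw [← Complex.exp_add, ← Complex.exp_add]
    ring_nf
  simp only
  rw [hpow, ← Complex.ofReal_sum, sum_Icc_one_vonMangoldt, abs_of_pos (Real.exp_pos u),
    Complex.real_smul, psiExp]
  push_cast
  linear_combination (Chebyshev.psi (Real.exp u) : ℂ) * hexp

/-- The Laplace transform of `psiExp - 1` extends continuously to the closed right half-plane. -/
lemma exists_continuousOn_eq_laplace_psiExp_sub_one :
    ∃ g : ℂ → ℂ, ContinuousOn g {s | 0 ≤ s.re} ∧ ∀ s : ℂ, 0 < s.re →
      ∫ u in Ioi (0 : ℝ), ((psiExp u - 1 : ℝ) : ℂ) * Complex.exp (-s * u) = g s := by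
  have hne {s : ℂ} (hs : 0 ≤ s.re) : 1 + s ≠ 0 := fun h ↦ by
    have := congrArg Complex.re h
    simp at this
    linarith
  refine ⟨fun s ↦ (vonMangoldt.LFunctionResidueClassAux (1 : ZMod 1) (1 + s) - 1) / (1 + s),
    ?_, fun s hs ↦ ?_⟩
  · refine ContinuousOn.div (ContinuousOn.sub ?_ continuousOn_const) (by fun_prop)
      fun s hs ↦ hne hs
    exact (vonMangoldt.continuousOn_LFunctionResidueClassAux (1 : ZMod 1)).comp (by fun_prop)
      fun s hs ↦ by simpa using hs
  · have hexp : IntegrableOn (fun u : ℝ ↦ Complex.exp (-s * u)) (Ioi 0) :=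
      integrableOn_exp_mul_complex_Ioi (by simpa using hs) 0
    have hpsi : IntegrableOn (fun u : ℝ ↦ (psiExp u : ℂ) * Complex.exp (-s * u)) (Ioi 0) :=
      hexp.bdd_mul (c := Real.log 4 + 4)
        (Complex.measurable_ofReal.comp measurable_psiExp).aestronglyMeasurable
        (ae_of_all _ fun u ↦ by
          rw [Complex.norm_real, Real.norm_of_nonneg (psiExp_nonneg u)]
          exact psiExp_le u)
    have hclass : vonMangoldt.residueClass (1 : ZMod 1) = fun n ↦ Λ n := by
      ext n
      simp [vonMangoldt.residueClass, Subsingleton.elim _ (1 : ZMod 1)]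
    have haux := vonMangoldt.eqOn_LFunctionResidueClassAux (isUnit_one (M := ZMod 1))
      (show 1 + s ∈ {s : ℂ | 1 < s.re} by simpa using hs)
    simp only [hclass, Nat.totient_one, Nat.cast_one, inv_one, add_sub_cancel_left] at haux
    beta_reduce
    rw [haux, LSeries_vonMangoldt_eq_mul_laplace hs]
    simp only [Complex.ofReal_sub, Complex.ofReal_one, sub_mul, one_mul]
    rw [integral_sub hpsi hexp, integral_exp_mul_complex_Ioi (by simpa using hs)]
    have hs0 : s ≠ 0 := fun h ↦ by simp [h] at hs
    have := hne hs.le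
    field_simp
    simp
    ring

theorem tendsto_psiExp : Tendsto psiExp atTop (𝓝 1) := by
  obtain ⟨g, hg, hL⟩ := exists_continuousOn_eq_laplace_psiExp_sub_one
  refine tendsto_one_of_tendsto_bandlimited measurable_psiExp psiExp_nonneg psiExp_le
    (fun _ _ ↦ psiExp_le_exp_mul) fun φ hφ hφc hφi ↦ ?_
  refine tendsto_setIntegral_mul_fourier_sub (A := fun u ↦ psiExp u - 1) (C := Real.log 4 + 4 + 1)
    (measurable_psiExp.sub_const 1) (fun u ↦ ?_) hg hL hφ hφc hφi
  have := psiExp_nonneg u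
  have := psiExp_le u
  rw [abs_le]
  constructor <;> linarith

end PrimeNumberTheorem

open ArithmeticFunction in
/-- The prime number theorem: `(1/N) ∑_{n ≤ N} Λ(n) → 1` as `N → ∞`. -/
theorem prime_number_theorem :
    Filter.Tendsto (fun N : ℕ => (1 / (N : ℝ)) * ∑ n ∈ Finset.Icc 1 N, Λ n)
      Filter.atTop (nhds 1) := by
  have hlog : Tendsto (fun N : ℕ ↦ Real.log N) atTop atTop :=
    Real.tendsto_log_atTop.comp tendsto_natCast_atTop_atTop
  refine (PrimeNumberTheorem.tendsto_psiExp.comp hlog).congr' ?_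
  filter_upwards [eventually_gt_atTop 0] with N hN
  have hN' : (0 : ℝ) < N := Nat.cast_pos.2 hN
  have h := PrimeNumberTheorem.sum_Icc_one_vonMangoldt N
  rw [Nat.floor_natCast] at h
  rw [Function.comp_apply, PrimeNumberTheorem.psiExp, Real.exp_neg, Real.exp_log hN', h,
    mul_comm, one_div]
end
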